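/- arXiv:2105.12520 — 4 statements merged into one kernel-verified Lean document; each statement's English description precedes it below -/
import Mathlib

section
/- Let q be a prime power and n, k, m, r positive integers with k | m, m | r, and r | n. Let γ ∈ F_{q^m}^* be a root of an irreducible polynomial of degree m/k over F_{q^k}, where m/k > 4; let ξ ∈ F_{q^r}^* be a root of an irreducible polynomial of degree r/m over F_{q^m}, where r/m > 2; and let ζ ∈ F_{q^n}^* be a root of an irreducible polynomial of degree n/r over F_{q^r}, where n/r > 4. Let δ_1, δ_2, τ_1, τ_2, η_1, η_2 ∈ F_{q^k}^*. Then U = {δ_1 a + δ_2 a^q ξ + τ_1 u γ + τ_2 u^q γ^2 + η_1 e ζ + η_2 e^q ζ^2 : a, u, e ∈ F_{q^k}} is a Sidon space of F_q-dimension 3k. -/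
open Submodule Pointwise

set_option maxHeartbeats 1000000
set_option synthInstance.maxHeartbeats 400000

/-- An `F`-subspace `V` of a field `K` is a *Sidon space* if for all nonzero
`a, b, c, d ∈ V` with `a * b = c * d` one has `{aF, bF} = {cF, dF}` (as a pair of
one-dimensional `F`-subspaces). -/
def IsSidonSpace {K : Type*} [Field K] (F : Subfield K) (V : Submodule F K) : Prop :=
  ∀ a ∈ V, ∀ b ∈ V, ∀ c ∈ V, ∀ d ∈ V,
    a ≠ 0 → b ≠ 0 → c ≠ 0 → d ≠ 0 → a * b = c * d →
    ({Submodule.span F {a}, Submodule.span F {b}} : Set (Submodule F K)) =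
      {Submodule.span F {c}, Submodule.span F {d}}

/-- If `n` is at most the degree of `t` over `S`, then a vanishing `S`-linear combination of
`1, t, …, t ^ (n - 1)` is trivial. -/
theorem eq_zero_of_sum_mul_pow_eq_zero {K : Type*} [Field K] (S : Subfield K) (t : K) {n : ℕ}
    (hn : n ≤ (minpoly S t).natDegree) (c : Fin n → K) (hc : ∀ i, c i ∈ S)
    (h : ∑ i, c i * t ^ (i : ℕ) = 0) (i : Fin n) : c i = 0 := by
  have hli := (linearIndependent_pow (K := S) t).comp (Fin.castLE hn) (Fin.castLE_injective hn)
  rw [Fintype.linearIndependent_iff] at hli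
  simpa using congrArg Subtype.val
    (hli (fun i => ⟨c i, hc i⟩) (by simpa [Subfield.smul_def] using h) i)

/-- Linear forms are prime: if the product of the linear forms with coefficient vectors `x`, `y`
equals that of the forms with coefficient vectors `z`, `w`, then `x` is proportional to
`z` or to `w`. -/
theorem proportional_of_symm_mul_eq {ι K : Type*} [Field K] {x y z w : ι → K} {i₀ : ι}
    (hdiag : ∀ i, x i * y i = z i * w i)
    (hcross : ∀ i j, x i * y j + x j * y i = z i * w j + z j * w i) :
    (∀ j, x i₀ * z j = z i₀ * x j) ∨ ∀ j, x i₀ * w j = w i₀ * x j := by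
  have key : ∀ j l, (x i₀ * z j - z i₀ * x j) * (x i₀ * w l - w i₀ * x l) +
      (x i₀ * z l - z i₀ * x l) * (x i₀ * w j - w i₀ * x j) = 0 := fun j l => by
    linear_combination (-x i₀ ^ 2) * hcross j l + x i₀ * x l * hcross i₀ j +
      x i₀ * x j * hcross i₀ l - 2 * x j * x l * hdiag i₀
  have key' : ∀ j, (x i₀ * z j - z i₀ * x j) * (x i₀ * w j - w i₀ * x j) = 0 := fun j => by
    linear_combination (-x i₀ ^ 2) * hdiag j + x i₀ * x j * hcross i₀ j - x j ^ 2 * hdiag i₀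
  by_contra! hcon
  obtain ⟨⟨j, hj⟩, l, hl⟩ := hcon
  have hj' := (mul_eq_zero.mp (key' j)).resolve_left (sub_ne_zero.mpr hj)
  have h := key j l
  rw [hj', mul_zero, add_zero] at h
  exact mul_ne_zero (sub_ne_zero.mpr hj) (sub_ne_zero.mpr hl) h

/-- A subfield with `q` elements contains every root of `X ^ q - X`. -/
theorem mem_of_pow_natCard_eq {K : Type*} [Field K] (F : Subfield K) [Finite F] {c : K}
    (h : c ^ Nat.card F = c) : c ∈ F := by
  classical
  have := Fintype.ofFinite F
  by_contra hc
  have h1 : 1 < Nat.card F := Finite.one_lt_card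
  refine FiniteField.X_pow_card_sub_X_ne_zero K h1 <|
    Polynomial.eq_zero_of_natDegree_lt_card_of_eval_eq_zero' _
      (insert c (Finset.univ.image ((↑) : F → K))) ?_ ?_
  · intro i hi
    simp only [Finset.mem_insert, Finset.mem_image, Finset.mem_univ, true_and] at hi
    obtain rfl | ⟨y, rfl⟩ := hi
    · simp only [Polynomial.eval_sub, Polynomial.eval_pow, Polynomial.eval_X, h, sub_self]
    · have := congrArg Subtype.val (FiniteField.pow_card y)
      simpa [sub_eq_zero] using this
  · rw [FiniteField.X_pow_card_sub_X_natDegree_eq K h1, Finset.card_insert_of_notMem,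
      Finset.card_image_of_injective _ Subtype.val_injective, Finset.card_univ,
      Nat.card_eq_fintype_card]
    · exact Nat.lt_succ_self _
    · simpa using hc

/-- If `x y = z w` and `z` is a nonzero `F`-multiple of `x`, then the factors on both sides span
the same lines. -/
theorem span_pair_eq_of_mul_eq {K : Type*} [Field K] {F : Subfield K} {x y z w c : K}
    (hc : c ∈ F) (hc0 : c ≠ 0) (hx : x ≠ 0) (hz : z = c * x) (h : x * y = z * w) :
    ({Submodule.span F {x}, Submodule.span F {y}} : Set (Submodule F K)) =
      {Submodule.span F {z}, Submodule.span F {w}} := by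
  have hy : y = c * w := mul_left_cancel₀ hx (by rw [h, hz]; ring)
  have hu : IsUnit (⟨c, hc⟩ : F) := (Ne.isUnit (by simpa [Subtype.ext_iff] using hc0))
  have hspan : ∀ t : K, Submodule.span F {c * t} = Submodule.span F {t} := fun t =>
    Submodule.span_singleton_smul_eq hu t
  rw [hz, hy, hspan, hspan]

section Tower

variable {K : Type*} [Field K] {F Fk Fm Fr : Subfield K} {γ ξ ζ : K}

/-- Coefficient comparison for products of two quadratic polynomials in `t`. -/
theorem coeff_eq_of_quadratic_mul_eq {S : Subfield K} {t : K}
    (ht : 4 < (minpoly S t).natDegree) {p₀ p₁ p₂ s₀ s₁ s₂ v₀ v₁ v₂ w₀ w₁ w₂ : K}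
    (hp₀ : p₀ ∈ S) (hp₁ : p₁ ∈ S) (hp₂ : p₂ ∈ S) (hs₀ : s₀ ∈ S) (hs₁ : s₁ ∈ S) (hs₂ : s₂ ∈ S)
    (hv₀ : v₀ ∈ S) (hv₁ : v₁ ∈ S) (hv₂ : v₂ ∈ S) (hw₀ : w₀ ∈ S) (hw₁ : w₁ ∈ S) (hw₂ : w₂ ∈ S)
    (h : (p₀ + p₁ * t + p₂ * t ^ 2) * (s₀ + s₁ * t + s₂ * t ^ 2) =
      (v₀ + v₁ * t + v₂ * t ^ 2) * (w₀ + w₁ * t + w₂ * t ^ 2)) :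
    p₀ * s₀ = v₀ * w₀ ∧ p₀ * s₁ + p₁ * s₀ = v₀ * w₁ + v₁ * w₀ ∧
      p₀ * s₂ + p₁ * s₁ + p₂ * s₀ = v₀ * w₂ + v₁ * w₁ + v₂ * w₀ ∧
      p₁ * s₂ + p₂ * s₁ = v₁ * w₂ + v₂ * w₁ ∧ p₂ * s₂ = v₂ * w₂ := by
  have hc := eq_zero_of_sum_mul_pow_eq_zero S t (n := 5) ht
    ![p₀ * s₀ - v₀ * w₀, p₀ * s₁ + p₁ * s₀ - (v₀ * w₁ + v₁ * w₀),
      p₀ * s₂ + p₁ * s₁ + p₂ * s₀ - (v₀ * w₂ + v₁ * w₁ + v₂ * w₀),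
      p₁ * s₂ + p₂ * s₁ - (v₁ * w₂ + v₂ * w₁), p₂ * s₂ - v₂ * w₂]
    (by
      simp only [Fin.forall_fin_succ, Matrix.cons_val_zero, Matrix.cons_val_succ, IsEmpty.forall_iff,
        and_true]
      refine ⟨?_, ?_, ?_, ?_, ?_⟩ <;>
        apply_rules [Subfield.sub_mem, Subfield.add_mem, Subfield.mul_mem])
    (by
      simp only [Fin.sum_univ_five, Matrix.cons_val]
      norm_num
      linear_combination h)
  have h0 := hc 0
  have h1 := hc 1
  have h2 := hc 2
  have h3 := hc 3
  have h4 := hc 4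
  simp only [Matrix.cons_val] at h0 h1 h2 h3 h4
  exact ⟨sub_eq_zero.mp h0, sub_eq_zero.mp h1, sub_eq_zero.mp h2, sub_eq_zero.mp h3,
    sub_eq_zero.mp h4⟩

/-- Coefficient comparison for quadratic polynomials in `t`. -/
theorem coeff_eq_of_quadratic_eq {S : Subfield K} {t : K}
    (ht : 2 < (minpoly S t).natDegree) {p₀ p₁ p₂ s₀ s₁ s₂ : K}
    (hp₀ : p₀ ∈ S) (hp₁ : p₁ ∈ S) (hp₂ : p₂ ∈ S) (hs₀ : s₀ ∈ S) (hs₁ : s₁ ∈ S) (hs₂ : s₂ ∈ S)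
    (h : p₀ + p₁ * t + p₂ * t ^ 2 = s₀ + s₁ * t + s₂ * t ^ 2) :
    p₀ = s₀ ∧ p₁ = s₁ ∧ p₂ = s₂ := by
  have hc := eq_zero_of_sum_mul_pow_eq_zero S t (n := 3) ht ![p₀ - s₀, p₁ - s₁, p₂ - s₂]
    (by
      simp only [Fin.forall_fin_succ, Matrix.cons_val_zero, Matrix.cons_val_succ, IsEmpty.forall_iff,
        and_true]
      refine ⟨?_, ?_, ?_⟩ <;> apply_rules [Subfield.sub_mem])
    (by
      simp only [Fin.sum_univ_three, Matrix.cons_val]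
      norm_num
      linear_combination h)
  have h0 := hc 0
  have h1 := hc 1
  have h2 := hc 2
  simp only [Matrix.cons_val] at h0 h1 h2
  exact ⟨sub_eq_zero.mp h0, sub_eq_zero.mp h1, sub_eq_zero.mp h2⟩

/-- The product of two combinations of `1, ξ, γ, γ², ζ, ζ²` over `Fk` determines the symmetric
product of the coordinate vectors, provided the `γ²`- and `ζ²`-coordinates control the `γ`- and
`ζ`-coordinates. -/
theorem symm_mul_eq_of_mul_eq (hkm : Fk ≤ Fm) (hmr : Fm ≤ Fr) (hγ : γ ∈ Fm) (hξ : ξ ∈ Fr)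
    (hdγ : 4 < (minpoly Fk γ).natDegree) (hdξ : 2 < (minpoly Fm ξ).natDegree)
    (hdζ : 4 < (minpoly Fr ζ).natDegree) {x y z w : Fin 6 → K}
    (hx : ∀ i, x i ∈ Fk) (hy : ∀ i, y i ∈ Fk) (hz : ∀ i, z i ∈ Fk) (hw : ∀ i, w i ∈ Fk)
    (hu : x 3 * y 3 = z 3 * w 3 → x 2 * y 2 = z 2 * w 2)
    (he : x 5 * y 5 = z 5 * w 5 → x 4 * y 4 = z 4 * w 4)
    (h : (x 0 + x 1 * ξ + x 2 * γ + x 3 * γ ^ 2 + x 4 * ζ + x 5 * ζ ^ 2) *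
        (y 0 + y 1 * ξ + y 2 * γ + y 3 * γ ^ 2 + y 4 * ζ + y 5 * ζ ^ 2) =
      (z 0 + z 1 * ξ + z 2 * γ + z 3 * γ ^ 2 + z 4 * ζ + z 5 * ζ ^ 2) *
        (w 0 + w 1 * ξ + w 2 * γ + w 3 * γ ^ 2 + w 4 * ζ + w 5 * ζ ^ 2)) :
    (∀ i, x i * y i = z i * w i) ∧
      ∀ i j, x i * y j + x j * y i = z i * w j + z j * w i := by
  have hkr := hkm.trans hmr
  have mm : ∀ {v : Fin 6 → K}, (∀ i, v i ∈ Fk) → v 0 + v 2 * γ + v 3 * γ ^ 2 ∈ Fm := fun hv =>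
    add_mem (add_mem (hkm (hv 0)) (mul_mem (hkm (hv 2)) hγ)) (mul_mem (hkm (hv 3)) (pow_mem hγ 2))
  have mr : ∀ {v : Fin 6 → K}, (∀ i, v i ∈ Fk) →
      v 0 + v 2 * γ + v 3 * γ ^ 2 + v 1 * ξ ∈ Fr := fun hv =>
    add_mem (hmr (mm hv)) (mul_mem (hkr (hv 1)) hξ)
  -- A relation between `ζ`-coefficients splits along the basis `1, ξ, γ, γ²`.
  have split : ∀ {p s v t : K}, p ∈ Fk → s ∈ Fk → v ∈ Fk → t ∈ Fk →
      (x 0 + x 2 * γ + x 3 * γ ^ 2 + x 1 * ξ) * s + p * (y 0 + y 2 * γ + y 3 * γ ^ 2 + y 1 * ξ) =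
        (z 0 + z 2 * γ + z 3 * γ ^ 2 + z 1 * ξ) * t +
          v * (w 0 + w 2 * γ + w 3 * γ ^ 2 + w 1 * ξ) →
      (x 0 * s + p * y 0 = z 0 * t + v * w 0) ∧ (x 1 * s + p * y 1 = z 1 * t + v * w 1) ∧
      (x 2 * s + p * y 2 = z 2 * t + v * w 2) ∧ (x 3 * s + p * y 3 = z 3 * t + v * w 3) := by
    intro p s v t hp hs hv ht hh
    have mk : ∀ {c d c' d' : K}, c ∈ Fk → d ∈ Fk → c' ∈ Fk → d' ∈ Fk → c * d + c' * d' ∈ Fk :=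
      fun h₁ h₂ h₃ h₄ => add_mem (mul_mem h₁ h₂) (mul_mem h₃ h₄)
    obtain ⟨h0, h1, -⟩ := coeff_eq_of_quadratic_eq hdξ
      (p₀ := (x 0 + x 2 * γ + x 3 * γ ^ 2) * s + p * (y 0 + y 2 * γ + y 3 * γ ^ 2))
      (p₁ := x 1 * s + p * y 1) (p₂ := 0)
      (s₀ := (z 0 + z 2 * γ + z 3 * γ ^ 2) * t + v * (w 0 + w 2 * γ + w 3 * γ ^ 2))
      (s₁ := z 1 * t + v * w 1) (s₂ := 0)
      (add_mem (mul_mem (mm hx) (hkm hs)) (mul_mem (hkm hp) (mm hy)))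
      (hkm (mk (hx 1) hs hp (hy 1))) (zero_mem _)
      (add_mem (mul_mem (mm hz) (hkm ht)) (mul_mem (hkm hv) (mm hw)))
      (hkm (mk (hz 1) ht hv (hw 1))) (zero_mem _) (by linear_combination hh)
    obtain ⟨h2, h3, h4⟩ := coeff_eq_of_quadratic_eq (by omega : 2 < (minpoly Fk γ).natDegree)
      (mk (hx 0) hs hp (hy 0)) (mk (hx 2) hs hp (hy 2)) (mk (hx 3) hs hp (hy 3))
      (mk (hz 0) ht hv (hw 0)) (mk (hz 2) ht hv (hw 2)) (mk (hz 3) ht hv (hw 3))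
      (by linear_combination h0)
    exact ⟨h2, h1, h3, h4⟩
  obtain ⟨z0, z1, z2, z45, z55⟩ := coeff_eq_of_quadratic_mul_eq hdζ
    (mr hx) (hkr (hx 4)) (hkr (hx 5)) (mr hy) (hkr (hy 4)) (hkr (hy 5))
    (mr hz) (hkr (hz 4)) (hkr (hz 5)) (mr hw) (hkr (hw 4)) (hkr (hw 5))
    (by linear_combination h)
  have z44 := he z55
  obtain ⟨z04, z14, z24, z34⟩ := split (hx 4) (hy 4) (hz 4) (hw 4) z1
  obtain ⟨z05, z15, z25, z35⟩ := split (hx 5) (hy 5) (hz 5) (hw 5) (by linear_combination z2 - z44)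
  obtain ⟨x0, x1, z11⟩ := coeff_eq_of_quadratic_eq hdξ
    (p₀ := (x 0 + x 2 * γ + x 3 * γ ^ 2) * (y 0 + y 2 * γ + y 3 * γ ^ 2))
    (p₁ := (x 0 + x 2 * γ + x 3 * γ ^ 2) * y 1 + x 1 * (y 0 + y 2 * γ + y 3 * γ ^ 2))
    (p₂ := x 1 * y 1)
    (s₀ := (z 0 + z 2 * γ + z 3 * γ ^ 2) * (w 0 + w 2 * γ + w 3 * γ ^ 2))
    (s₁ := (z 0 + z 2 * γ + z 3 * γ ^ 2) * w 1 + z 1 * (w 0 + w 2 * γ + w 3 * γ ^ 2))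
    (s₂ := z 1 * w 1)
    (mul_mem (mm hx) (mm hy))
    (add_mem (mul_mem (mm hx) (hkm (hy 1))) (mul_mem (hkm (hx 1)) (mm hy)))
    (hkm (mul_mem (hx 1) (hy 1)))
    (mul_mem (mm hz) (mm hw))
    (add_mem (mul_mem (mm hz) (hkm (hw 1))) (mul_mem (hkm (hz 1)) (mm hw)))
    (hkm (mul_mem (hz 1) (hw 1))) (by linear_combination z0)
  obtain ⟨z00, z02, g2, z23, z33⟩ := coeff_eq_of_quadratic_mul_eq hdγ (hx 0) (hx 2) (hx 3)
    (hy 0) (hy 2) (hy 3) (hz 0) (hz 2) (hz 3) (hw 0) (hw 2) (hw 3) x0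
  have z22 := hu z33
  have z03 : x 0 * y 3 + x 3 * y 0 = z 0 * w 3 + z 3 * w 0 := by linear_combination g2 - z22
  have mk : ∀ {v v' : Fin 6 → K}, (∀ i, v i ∈ Fk) → (∀ i, v' i ∈ Fk) → ∀ i,
      v i * v' 1 + v 1 * v' i ∈ Fk := fun h₁ h₂ i =>
    add_mem (mul_mem (h₁ i) (h₂ 1)) (mul_mem (h₁ 1) (h₂ i))
  obtain ⟨z01, z21, z31⟩ := coeff_eq_of_quadratic_eq (by omega : 2 < (minpoly Fk γ).natDegree)
      (mk hx hy 0) (mk hx hy 2) (mk hx hy 3) (mk hz hw 0) (mk hz hw 2) (mk hz hw 3)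
      (by linear_combination x1)
  have hdiag : ∀ i, x i * y i = z i * w i := by
    intro i
    fin_cases i <;> assumption
  have hlt : ∀ i j, i < j → x i * y j + x j * y i = z i * w j + z j * w i := by
    intro i j hij
    fin_cases i <;> fin_cases j <;> first
      | exact absurd hij (by decide)
      | assumption
      | (rw [add_comm, add_comm (z _ * _)]; assumption)
  refine ⟨hdiag, fun i j => ?_⟩
  obtain hij | rfl | hij := lt_trichotomy i j
  · exact hlt i j hij
  · rw [hdiag]
  · rw [add_comm, add_comm (z i * _)]
    exact hlt j i hij
/-- The element with coordinates `x` with respect to `1, ξ, γ, γ², ζ, ζ²`. -/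
def combination (γ ξ ζ : K) (x : Fin 6 → K) : K :=
  x 0 + x 1 * ξ + x 2 * γ + x 3 * γ ^ 2 + x 4 * ζ + x 5 * ζ ^ 2

/-- The coordinates `d₀ v₀, d₁ v₀ ^ q, d₂ v₁, d₃ v₁ ^ q, d₄ v₂, d₅ v₂ ^ q`. -/
def twistedCoords (q : ℕ) (d : Fin 6 → K) (v : Fin 3 → K) : Fin 6 → K :=
  ![d 0 * v 0, d 1 * v 0 ^ q, d 2 * v 1, d 3 * v 1 ^ q, d 4 * v 2, d 5 * v 2 ^ q]

theorem combination_smul (c : K) (x : Fin 6 → K) :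
    combination γ ξ ζ (c • x) = c * combination γ ξ ζ x := by
  simp only [combination, Pi.smul_apply, smul_eq_mul]
  ring

theorem twistedCoords_mem {q : ℕ} {d : Fin 6 → K} {v : Fin 3 → K} (hd : ∀ i, d i ∈ Fk)
    (hv : ∀ l, v l ∈ Fk) (i : Fin 6) : twistedCoords q d v i ∈ Fk := by
  fin_cases i <;> first
    | exact mul_mem (hd _) (hv _)
    | exact mul_mem (hd _) (pow_mem (hv _) _)

theorem eq_zero_of_twistedCoords_eq_zero {q : ℕ} {d : Fin 6 → K} (hd : ∀ i, d i ≠ 0)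
    {v : Fin 3 → K} (h : twistedCoords q d v = 0) : v = 0 := by
  funext l
  fin_cases l
  · exact (mul_eq_zero.mp (congrFun h 0)).resolve_left (hd 0)
  · exact (mul_eq_zero.mp (congrFun h 2)).resolve_left (hd 2)
  · exact (mul_eq_zero.mp (congrFun h 4)).resolve_left (hd 4)

/-- Proportional twisted coordinate vectors are proportional by a scalar of the subfield with
`q` elements. -/
theorem exists_mem_smul_of_proportional [Finite F] {d : Fin 6 → K} (hd : ∀ i, d i ≠ 0)
    {v w : Fin 3 → K} {i : Fin 6} (hi : twistedCoords (Nat.card F) d v i ≠ 0)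
    (h : ∀ j, twistedCoords (Nat.card F) d v i * twistedCoords (Nat.card F) d w j =
      twistedCoords (Nat.card F) d w i * twistedCoords (Nat.card F) d v j) :
    ∃ c ∈ F, twistedCoords (Nat.card F) d w = c • twistedCoords (Nat.card F) d v := by
  set c := twistedCoords (Nat.card F) d w i / twistedCoords (Nat.card F) d v i with hc
  have hw : ∀ j, twistedCoords (Nat.card F) d w j = c * twistedCoords (Nat.card F) d v j := by
    intro j
    rw [hc, div_mul_eq_mul_div, ← h j, mul_div_cancel_left₀ _ hi]
  refine ⟨c, ?_, funext hw⟩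
  have cancel : ∀ {a s t : K}, a ≠ 0 → a * s = c * (a * t) → s = c * t := fun ha hst =>
    mul_left_cancel₀ ha (by rw [hst]; ring)
  have hlin : ∀ l, w l = c * v l := by
    intro l
    fin_cases l
    · exact cancel (hd 0) (hw 0)
    · exact cancel (hd 2) (hw 2)
    · exact cancel (hd 4) (hw 4)
  have hpow : ∀ l, w l ^ Nat.card F = c * v l ^ Nat.card F := by
    intro l
    fin_cases l
    · exact cancel (hd 1) (hw 1)
    · exact cancel (hd 3) (hw 3)
    · exact cancel (hd 5) (hw 5)
  have hv : v ≠ 0 := by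
    rintro rfl
    apply hi
    have : Nat.card F ≠ 0 := Nat.card_pos.ne'
    fin_cases i <;> simp [twistedCoords, this]
  obtain ⟨l, hl⟩ := Function.ne_iff.mp hv
  refine mem_of_pow_natCard_eq F (mul_right_cancel₀ (pow_ne_zero (Nat.card F) hl) ?_)
  rw [Pi.zero_apply] at *
  rw [← mul_pow, ← hlin, hpow]

theorem pow_natCard_injective [Finite K] (F : Subfield K) :
    Function.Injective fun x : K => x ^ Nat.card F := by
  have := Fintype.ofFinite F
  rw [Nat.card_eq_fintype_card]
  exact (FiniteField.frobeniusAlgHom F K).toRingHom.injective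

theorem add_pow_natCard (F : Subfield K) [Finite F] (x y : K) :
    (x + y) ^ Nat.card F = x ^ Nat.card F + y ^ Nat.card F := by
  have := Fintype.ofFinite F
  rw [Nat.card_eq_fintype_card]
  exact map_add (FiniteField.frobeniusAlgHom F K) x y

theorem sub_pow_natCard (F : Subfield K) [Finite F] (x y : K) :
    (x - y) ^ Nat.card F = x ^ Nat.card F - y ^ Nat.card F := by
  have := Fintype.ofFinite F
  rw [Nat.card_eq_fintype_card]
  exact map_sub (FiniteField.frobeniusAlgHom F K) x y

theorem mul_pow_natCard (F : Subfield K) [Finite F] {c : K} (hc : c ∈ F) (x : K) :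
    (c * x) ^ Nat.card F = c * x ^ Nat.card F := by
  have := Fintype.ofFinite F
  rw [mul_pow, Nat.card_eq_fintype_card]
  exact congrArg (· * _) (congrArg Subtype.val (FiniteField.pow_card (⟨c, hc⟩ : F)))

theorem twistedCoords_symm_mul_eq [Finite K] (hkm : Fk ≤ Fm) (hmr : Fm ≤ Fr) (hγ : γ ∈ Fm)
    (hξ : ξ ∈ Fr) (hdγ : 4 < (minpoly Fk γ).natDegree) (hdξ : 2 < (minpoly Fm ξ).natDegree)
    (hdζ : 4 < (minpoly Fr ζ).natDegree) {d : Fin 6 → K} (hd : ∀ i, d i ∈ Fk)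
    (hd0 : ∀ i, d i ≠ 0) {x y z w : Fin 3 → K}
    (hx : ∀ i, x i ∈ Fk) (hy : ∀ i, y i ∈ Fk) (hz : ∀ i, z i ∈ Fk) (hw : ∀ i, w i ∈ Fk)
    (h : combination γ ξ ζ (twistedCoords (Nat.card F) d x) *
        combination γ ξ ζ (twistedCoords (Nat.card F) d y) =
      combination γ ξ ζ (twistedCoords (Nat.card F) d z) *
        combination γ ξ ζ (twistedCoords (Nat.card F) d w)) :
    (∀ i, twistedCoords (Nat.card F) d x i * twistedCoords (Nat.card F) d y i =
        twistedCoords (Nat.card F) d z i * twistedCoords (Nat.card F) d w i) ∧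
      ∀ i j, twistedCoords (Nat.card F) d x i * twistedCoords (Nat.card F) d y j +
          twistedCoords (Nat.card F) d x j * twistedCoords (Nat.card F) d y i =
        twistedCoords (Nat.card F) d z i * twistedCoords (Nat.card F) d w j +
          twistedCoords (Nat.card F) d z j * twistedCoords (Nat.card F) d w i := by
  have hσ : ∀ {a b s t s' t' : K}, a ≠ 0 →
      a * s ^ Nat.card F * (a * t ^ Nat.card F) = a * s' ^ Nat.card F * (a * t' ^ Nat.card F) →
      b * s * (b * t) = b * s' * (b * t') := by
    intro a b s t s' t' ha hh
    have : s * t = s' * t' := pow_natCard_injective F <| by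
      refine mul_left_cancel₀ (mul_ne_zero ha ha) ?_
      simp only [mul_pow]
      linear_combination hh
    linear_combination b ^ 2 * this
  exact symm_mul_eq_of_mul_eq hkm hmr hγ hξ hdγ hdξ hdζ (twistedCoords_mem hd hx)
    (twistedCoords_mem hd hy) (twistedCoords_mem hd hz) (twistedCoords_mem hd hw)
    (hσ (hd0 3)) (hσ (hd0 5)) h

/-- The set of all `combination γ ξ ζ (twistedCoords q d v)`, as a subspace over the subfield
with `q` elements. -/
def twistedSubspace (F Fk : Subfield K) [Finite F] (hF : F ≤ Fk) (γ ξ ζ : K) (d : Fin 6 → K) :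
    Submodule F K where
  carrier := {t | ∃ v : Fin 3 → K, (∀ l, v l ∈ Fk) ∧
    t = combination γ ξ ζ (twistedCoords (Nat.card F) d v)}
  add_mem' := by
    rintro _ _ ⟨v, hv, rfl⟩ ⟨w, hw, rfl⟩
    refine ⟨v + w, fun l => add_mem (hv l) (hw l), ?_⟩
    simp only [combination, twistedCoords, Matrix.cons_val, Pi.add_apply, add_pow_natCard]
    ring
  zero_mem' := by
    refine ⟨0, fun l => zero_mem _, ?_⟩
    have : Nat.card F ≠ 0 := Nat.card_pos.ne'
    simp [combination, twistedCoords, this]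
  smul_mem' := by
    rintro ⟨c, hc⟩ _ ⟨v, hv, rfl⟩
    refine ⟨c • v, fun l => mul_mem (hF hc) (hv l), ?_⟩
    simp only [combination, twistedCoords, Matrix.cons_val, Pi.smul_apply, smul_eq_mul,
      mul_pow_natCard F hc, Subfield.smul_def]
    ring

theorem isSidonSpace_twistedSubspace [Finite K] (hF : F ≤ Fk) (hkm : Fk ≤ Fm) (hmr : Fm ≤ Fr)
    (hγ : γ ∈ Fm) (hξ : ξ ∈ Fr) (hdγ : 4 < (minpoly Fk γ).natDegree)
    (hdξ : 2 < (minpoly Fm ξ).natDegree) (hdζ : 4 < (minpoly Fr ζ).natDegree) {d : Fin 6 → K}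
    (hd : ∀ i, d i ∈ Fk) (hd0 : ∀ i, d i ≠ 0) :
    IsSidonSpace F (twistedSubspace F Fk hF γ ξ ζ d) := by
  rintro _ ⟨x, hx, rfl⟩ _ ⟨y, hy, rfl⟩ _ ⟨z, hz, rfl⟩ _ ⟨w, hw, rfl⟩ hx0 - hz0 hw0 h
  have hne : twistedCoords (Nat.card F) d x ≠ 0 := by
    intro h0
    exact hx0 (by simp [h0, combination])
  obtain ⟨i, hi⟩ := Function.ne_iff.mp hne
  obtain ⟨hdiag, hcross⟩ :=
    twistedCoords_symm_mul_eq hkm hmr hγ hξ hdγ hdξ hdζ hd hd0 hx hy hz hw h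
  have scalar : ∀ {t : Fin 3 → K}, combination γ ξ ζ (twistedCoords (Nat.card F) d t) ≠ 0 →
      (∀ j, twistedCoords (Nat.card F) d x i * twistedCoords (Nat.card F) d t j =
        twistedCoords (Nat.card F) d t i * twistedCoords (Nat.card F) d x j) →
      ∃ c ∈ F, c ≠ 0 ∧ combination γ ξ ζ (twistedCoords (Nat.card F) d t) =
        c * combination γ ξ ζ (twistedCoords (Nat.card F) d x) := by
    intro t ht hp
    obtain ⟨c, hc, heq⟩ := exists_mem_smul_of_proportional hd0 hi hp
    have heq' := (congrArg (combination γ ξ ζ) heq).trans (combination_smul _ _)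
    exact ⟨c, hc, left_ne_zero_of_mul (heq' ▸ ht), heq'⟩
  obtain hp | hp := proportional_of_symm_mul_eq (i₀ := i) hdiag hcross
  · obtain ⟨c, hc, hc0, heq⟩ := scalar hz0 hp
    exact span_pair_eq_of_mul_eq hc hc0 hx0 heq h
  · obtain ⟨c, hc, hc0, heq⟩ := scalar hw0 hp
    rw [Set.pair_comm (Submodule.span F {combination γ ξ ζ (twistedCoords (Nat.card F) d z)})]
    exact span_pair_eq_of_mul_eq hc hc0 hx0 heq (h.trans (mul_comm _ _))

theorem natCard_twistedSubspace [Finite K] (hF : F ≤ Fk) (hkm : Fk ≤ Fm) (hmr : Fm ≤ Fr)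
    (hγ : γ ∈ Fm) (hξ : ξ ∈ Fr) (hdγ : 4 < (minpoly Fk γ).natDegree)
    (hdξ : 2 < (minpoly Fm ξ).natDegree) (hdζ : 4 < (minpoly Fr ζ).natDegree) {d : Fin 6 → K}
    (hd : ∀ i, d i ∈ Fk) (hd0 : ∀ i, d i ≠ 0) :
    Nat.card (twistedSubspace F Fk hF γ ξ ζ d) = Nat.card Fk ^ 3 := by
  have hbij : Function.Bijective fun v : Fin 3 → Fk =>
      (⟨combination γ ξ ζ (twistedCoords (Nat.card F) d fun l => v l), fun l => v l,
        fun l => (v l).2, rfl⟩ : twistedSubspace F Fk hF γ ξ ζ d) := by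
    constructor
    · intro v w h
      have hsub : combination γ ξ ζ (twistedCoords (Nat.card F) d fun l => (v l : K) - w l) = 0 := by
        have h' := congrArg Subtype.val h
        simp only [combination, twistedCoords, Matrix.cons_val] at h'
        simp only [combination, twistedCoords, Matrix.cons_val, sub_pow_natCard]
        linear_combination h'
      have hmem : ∀ l, (v l : K) - w l ∈ Fk := fun l => sub_mem (v l).2 (w l).2
      have hz0 : twistedCoords (Nat.card F) d 0 = 0 := by
        have : Nat.card F ≠ 0 := Nat.card_pos.ne'
        ext i
        fin_cases i <;> simp [twistedCoords, this]
      have hdiag := (twistedCoords_symm_mul_eq (F := F) hkm hmr hγ hξ hdγ hdξ hdζ hd hd0 hmem hmem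
        (z := 0) (w := 0) (fun _ => zero_mem _) (fun _ => zero_mem _) (by
          rw [hsub, hz0]
          simp [combination])).1
      have h0 := eq_zero_of_twistedCoords_eq_zero hd0
        (funext fun i => mul_self_eq_zero.mp ((hdiag i).trans (by rw [hz0]; simp)))
      exact funext fun l => Subtype.ext (sub_eq_zero.mp (congrFun h0 l))
    · rintro ⟨_, v, hv, rfl⟩
      exact ⟨fun l => ⟨v l, hv l⟩, rfl⟩
  rw [← Nat.card_congr (Equiv.ofBijective _ hbij), Nat.card_fun]
  simp

end Tower

/-- For `k ∣ m ∣ r ∣ n`, with `γ ∈ F_{q^m}^*` of degree `m/k > 4` over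
`F_{q^k}`, `ξ ∈ F_{q^r}^*` of degree `r/m > 2` over `F_{q^m}`, and `ζ ∈ F_{q^n}^*` of
degree `n/r > 4` over `F_{q^r}`, the indicated set is a Sidon space of dimension `3k`. -/
theorem sidonSpace_three_generators_15 {K : Type*} [Field K] (q n k m r : ℕ)
    (hq : IsPrimePow q) (hn : 0 < n) (hk : 0 < k) (hm : 0 < m) (hr : 0 < r)
    (hkm : k ∣ m) (hmr : m ∣ r) (hrn : r ∣ n)
    (hK : Nat.card K = q ^ n)
    (F : Subfield K) (hF : Nat.card F = q)
    (Fk : Subfield K) (hFk : Nat.card Fk = q ^ k) (hFFk : F ≤ Fk)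
    (Fm : Subfield K) (hFm : Nat.card Fm = q ^ m) (hFkFm : Fk ≤ Fm)
    (Fr : Subfield K) (hFr : Nat.card Fr = q ^ r) (hFmFr : Fm ≤ Fr)
    (γ : K) (hγFm : γ ∈ Fm) (hγ : γ ≠ 0)
    (hdegγ : (minpoly Fk γ).natDegree = m / k) (hdegγ' : 4 < m / k)
    (ξ : K) (hξFr : ξ ∈ Fr) (hξ : ξ ≠ 0)
    (hdegξ : (minpoly Fm ξ).natDegree = r / m) (hdegξ' : 2 < r / m)
    (ζ : K) (hζ : ζ ≠ 0)
    (hdegζ : (minpoly Fr ζ).natDegree = n / r) (hdegζ' : 4 < n / r)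
    (δ₁ δ₂ τ₁ τ₂ η₁ η₂ : K)
    (hδ₁ : δ₁ ∈ Fk) (hδ₂ : δ₂ ∈ Fk) (hτ₁ : τ₁ ∈ Fk) (hτ₂ : τ₂ ∈ Fk)
    (hη₁ : η₁ ∈ Fk) (hη₂ : η₂ ∈ Fk)
    (hδ₁0 : δ₁ ≠ 0) (hδ₂0 : δ₂ ≠ 0) (hτ₁0 : τ₁ ≠ 0) (hτ₂0 : τ₂ ≠ 0)
    (hη₁0 : η₁ ≠ 0) (hη₂0 : η₂ ≠ 0) :
    IsSidonSpace F
        (Submodule.span F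
          {x : K | ∃ a ∈ Fk, ∃ u ∈ Fk, ∃ e ∈ Fk,
            x = δ₁ * a + δ₂ * a ^ q * ξ + τ₁ * u * γ + τ₂ * u ^ q * γ ^ 2 + η₁ * e * ζ + η₂ * e ^ q * ζ ^ 2}) ∧
      Module.finrank F
        ↥(Submodule.span F
          {x : K | ∃ a ∈ Fk, ∃ u ∈ Fk, ∃ e ∈ Fk,
            x = δ₁ * a + δ₂ * a ^ q * ξ + τ₁ * u * γ + τ₂ * u ^ q * γ ^ 2 + η₁ * e * ζ + η₂ * e ^ q * ζ ^ 2}) = 3 * k := by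
  have hfin : Finite K := Nat.finite_of_card_ne_zero (by rw [hK]; exact pow_ne_zero _ hq.ne_zero)
  subst hF
  have hd : ∀ i, ![δ₁, δ₂, τ₁, τ₂, η₁, η₂] i ∈ Fk := by
    intro i
    fin_cases i <;> assumption
  have hd0 : ∀ i, ![δ₁, δ₂, τ₁, τ₂, η₁, η₂] i ≠ 0 := by
    intro i
    fin_cases i <;> assumption
  have hspan : Submodule.span F {x : K | ∃ a ∈ Fk, ∃ u ∈ Fk, ∃ e ∈ Fk,
      x = δ₁ * a + δ₂ * a ^ Nat.card F * ξ + τ₁ * u * γ + τ₂ * u ^ Nat.card F * γ ^ 2 +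
        η₁ * e * ζ + η₂ * e ^ Nat.card F * ζ ^ 2} =
      twistedSubspace F Fk hFFk γ ξ ζ ![δ₁, δ₂, τ₁, τ₂, η₁, η₂] := by
    rw [← Submodule.span_eq (twistedSubspace F Fk hFFk γ ξ ζ ![δ₁, δ₂, τ₁, τ₂, η₁, η₂])]
    congr 1
    ext x
    constructor
    · rintro ⟨a, ha, u, hu, e, he, rfl⟩
      refine ⟨![a, u, e], ?_, rfl⟩
      intro l
      fin_cases l <;> assumption
    · rintro ⟨v, hv, rfl⟩
      exact ⟨v 0, hv 0, v 1, hv 1, v 2, hv 2, rfl⟩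
  rw [← hdegγ] at hdegγ'
  rw [← hdegξ] at hdegξ'
  rw [← hdegζ] at hdegζ'
  rw [hspan]
  refine ⟨isSidonSpace_twistedSubspace hFFk hFkFm hFmFr hγFm hξFr hdegγ' hdegξ' hdegζ' hd hd0, ?_⟩
  have hcard :=
    natCard_twistedSubspace hFFk hFkFm hFmFr hγFm hξFr hdegγ' hdegξ' hdegζ' hd hd0
  rw [Module.natCard_eq_pow_finrank (K := F), hFk, ← pow_mul] at hcard
  rw [Nat.pow_right_injective Finite.one_lt_card hcard, mul_comm]
end

section
/- Let q be a prime power and n, k positive integers with k | n and k ≥ 2. Let γ ∈ F_{q^n}^* be a root of an irreducible polynomial of degree n/k over F_{q^k}, where n/k > 2, and let δ ∈ F_{q^k} be an element that is not a (q−1)-th power of any element of F_{q^k}. Set U = {u + u^q γ : u ∈ F_{q^k}} and V = {δv + v^q γ : v ∈ F_{q^k}}. Then the collection C = {αU : α ∈ F_{q^n}^*} ∪ {βV : β ∈ F_{q^n}^*} of F_q-subspaces of F_{q^n} has cardinality 2(q^n − 1)/(q − 1) and minimum subspace distance 2k − 2. -/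
open Submodule Pointwise

set_option maxHeartbeats 1000000
set_option synthInstance.maxHeartbeats 400000

/-- The subspace distance `d(A,B) = dim A + dim B - 2 dim (A ⊓ B)`. -/
noncomputable def subspaceDist {K : Type*} [Field K] (F : Subfield K)
    (A B : Submodule F K) : ℕ :=
  Module.finrank F A + Module.finrank F B - 2 * Module.finrank F ↥(A ⊓ B)

/-- A collection `C` of `F`-subspaces has minimum subspace distance `d`. -/
def HasMinDist {K : Type*} [Field K] (F : Subfield K)
    (C : Set (Submodule F K)) (d : ℕ) : Prop :=
  IsLeast {e | ∃ A ∈ C, ∃ B ∈ C, A ≠ B ∧ e = subspaceDist F A B} d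

namespace Subfield

variable {K : Type*} [Field K]

/-- A subfield `L` containing `F`, as an `F`-subspace. -/
def toSubmoduleOfLE {F L : Subfield K} (h : F ≤ L) : Submodule F K where
  carrier := L
  add_mem' := L.add_mem
  zero_mem' := L.zero_mem
  smul_mem' c _ hx := L.mul_mem (h c.2) hx

theorem mem_toSubmoduleOfLE {F L : Subfield K} (h : F ≤ L) {x : K} :
    x ∈ toSubmoduleOfLE h ↔ x ∈ L := Iff.rfl

theorem pow_natCard_of_mem {F : Subfield K} [Finite F] {x : K} (hx : x ∈ F) :
    x ^ Nat.card F = x := by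
  have := Fintype.ofFinite F
  have h := FiniteField.pow_card (⟨x, hx⟩ : F)
  rw [← Nat.card_eq_fintype_card] at h
  exact congrArg Subtype.val h

theorem mem_iff_pow_natCard {F : Subfield K} [Finite F] {x : K} :
    x ∈ F ↔ x ^ Nat.card F = x := by
  refine ⟨pow_natCard_of_mem, fun hx => ?_⟩
  have h1 : 1 < Nat.card F := Finite.one_lt_card
  set p : Polynomial K := Polynomial.X ^ Nat.card F - Polynomial.X with hp
  have hp0 : p ≠ 0 := FiniteField.X_pow_card_sub_X_ne_zero K h1
  have hdeg : p.natDegree = Nat.card F := FiniteField.X_pow_card_sub_X_natDegree_eq K h1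
  have hsub : (F : Set K) ⊆ p.rootSet K := fun y hy => by
    rw [Polynomial.mem_rootSet]
    exact ⟨hp0, by simp [hp, pow_natCard_of_mem (show y ∈ F from hy)]⟩
  have heq := Set.eq_of_subset_of_ncard_le hsub (by
    calc (p.rootSet K).ncard ≤ p.natDegree := Polynomial.ncard_rootSet_le p K
      _ = (F : Set K).ncard := hdeg) (Polynomial.rootSet_finite p K)
  have hxr : x ∈ p.rootSet K := by
    rw [Polynomial.mem_rootSet]
    exact ⟨hp0, by simp [hp, hx]⟩
  exact heq.symm.subset hxr

end Subfield

/-- Over a field, quadratic polynomials do not vanish at an element whose minimal polynomial has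
degree larger than two. -/
theorem minpoly.quadratic_coeff_eq_zero {K : Type*} [Field K] {L : Subfield K} {γ : K}
    (h : 2 < (minpoly L γ).natDegree) {a b c : K} (ha : a ∈ L) (hb : b ∈ L) (hc : c ∈ L)
    (h0 : a + b * γ + c * γ ^ 2 = 0) : a = 0 ∧ b = 0 ∧ c = 0 := by
  set p : Polynomial L := Polynomial.C ⟨c, hc⟩ * Polynomial.X ^ 2 +
    Polynomial.C ⟨b, hb⟩ * Polynomial.X + Polynomial.C ⟨a, ha⟩ with hp
  have hroot : Polynomial.aeval γ p = 0 := by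
    simp only [hp, map_add, map_mul, map_pow, Polynomial.aeval_C, Polynomial.aeval_X]
    change c * γ ^ 2 + b * γ + a = 0
    linear_combination h0
  have hp0 : p = 0 := by
    by_contra hne
    have h1 := Polynomial.natDegree_le_natDegree (minpoly.degree_le_of_ne_zero L γ hne hroot)
    have h2 : p.natDegree ≤ 2 := Polynomial.natDegree_quadratic_le
    omega
  have e0 := congrArg (fun f => ((Polynomial.coeff f 0 : L) : K)) hp0
  have e1 := congrArg (fun f => ((Polynomial.coeff f 1 : L) : K)) hp0
  have e2 := congrArg (fun f => ((Polynomial.coeff f 2 : L) : K)) hp0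
  simp [hp, Polynomial.coeff_X, Polynomial.coeff_C] at e0 e1 e2
  exact ⟨e0, e1, e2⟩

section TwistedSpace

variable {K : Type*} [Field K]

/-- The `F`-linear map `u ↦ ε u + u ^ q γ`, where `q` is the cardinality of `F`. -/
noncomputable def twistedMap (F : Subfield K) [Finite F] (γ ε : K) : K →ₗ[F] K :=
  letI := Fintype.ofFinite F
  LinearMap.mulLeft F ε +
    LinearMap.mulRight F γ ∘ₗ (FiniteField.frobeniusAlgHom F K).toLinearMap

theorem twistedMap_apply (F : Subfield K) [Finite F] (γ ε u : K) :
    twistedMap F γ ε u = ε * u + u ^ Nat.card F * γ := by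
  simp [twistedMap, Fintype.card_eq_nat_card]

/-- The `F`-subspace `{ε u + u ^ q γ : u ∈ L}`, where `q` is the cardinality of `F`. -/
noncomputable def twistedSpace {F L : Subfield K} [Finite F] (h : F ≤ L) (γ ε : K) :
    Submodule F K :=
  (Subfield.toSubmoduleOfLE h).map (twistedMap F γ ε)

theorem span_twisted_eq {F L : Subfield K} [Finite F] (h : F ≤ L) (γ ε : K) :
    Submodule.span F {x : K | ∃ u ∈ L, x = ε * u + u ^ Nat.card F * γ} =
      twistedSpace h γ ε := by
  have : {x : K | ∃ u ∈ L, x = ε * u + u ^ Nat.card F * γ} =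
      (twistedSpace h γ ε : Set K) := by
    ext x
    simp only [twistedSpace, Submodule.map_coe, Set.mem_image, Set.mem_ofPred_eq,
      twistedMap_apply, SetLike.mem_coe, Subfield.mem_toSubmoduleOfLE]
    exact exists_congr fun u => and_congr_right fun _ => eq_comm
  rw [this, Submodule.span_eq]

theorem mem_smul_twistedSpace {F L : Subfield K} [Finite F] (h : F ≤ L) {γ ε α x : K} :
    x ∈ α • twistedSpace h γ ε ↔ ∃ u ∈ L, α * (ε * u + u ^ Nat.card F * γ) = x := by
  simp [twistedSpace, Submodule.mem_smul_pointwise_iff_exists, twistedMap_apply,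
    Subfield.mem_toSubmoduleOfLE]

theorem Submodule.smul_eq_self_of_mem {F : Subfield K} {c : K} (hc : c ∈ F) (hc0 : c ≠ 0)
    (W : Submodule F K) : c • W = W := by
  apply le_antisymm
  · intro x hx
    obtain ⟨y, hy, rfl⟩ := (Submodule.mem_smul_pointwise_iff_exists _ _ _).1 hx
    exact W.smul_mem ⟨c, hc⟩ hy
  · intro x hx
    refine (Submodule.mem_smul_pointwise_iff_exists _ _ _).2
      ⟨c⁻¹ * x, W.smul_mem ⟨c⁻¹, F.inv_mem hc⟩ hx, ?_⟩
    simp [hc0]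

variable {F L : Subfield K} [Finite F] {γ : K}

theorem twistedMap_eq_zero (hγ : 2 < (minpoly L γ).natDegree) {ε u : K} (hε : ε ∈ L)
    (hu : u ∈ L) (h : twistedMap F γ ε u = 0) : u = 0 := by
  rw [twistedMap_apply] at h
  have := minpoly.quadratic_coeff_eq_zero hγ (L.mul_mem hε hu) (pow_mem hu (Nat.card F))
    L.zero_mem (by linear_combination h)
  exact pow_eq_zero_iff (Nat.card_pos.ne') |>.1 this.2.1

theorem finrank_smul_twistedSpace [Finite K] (h : F ≤ L) (hγ : 2 < (minpoly L γ).natDegree)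
    {k : ℕ} (hL : Nat.card L = Nat.card F ^ k) {α ε : K} (hα : α ≠ 0) (hε : ε ∈ L) :
    Module.finrank F ↥(α • twistedSpace h γ ε) = k := by
  let f : L → ↥(α • twistedSpace h γ ε) := fun u =>
    ⟨α * (ε * u + (u : K) ^ Nat.card F * γ), (mem_smul_twistedSpace h).2 ⟨u, u.2, rfl⟩⟩
  have hf : Function.Bijective f := by
    constructor
    · intro u v huv
      have h1 : ε * u + (u : K) ^ Nat.card F * γ = ε * v + (v : K) ^ Nat.card F * γ :=
        mul_left_cancel₀ hα (congrArg Subtype.val huv)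
      rw [← twistedMap_apply, ← twistedMap_apply, ← sub_eq_zero, ← map_sub] at h1
      exact Subtype.ext (sub_eq_zero.1 (twistedMap_eq_zero hγ hε (L.sub_mem u.2 v.2) h1))
    · rintro ⟨x, hx⟩
      obtain ⟨u, hu, rfl⟩ := (mem_smul_twistedSpace h).1 hx
      exact ⟨⟨u, hu⟩, rfl⟩
  have h1 := Nat.card_congr (Equiv.ofBijective f hf)
  rw [hL, Module.natCard_eq_pow_finrank (K := F) (V := ↥(α • twistedSpace h γ ε))] at h1
  exact (Nat.pow_right_injective (Finite.one_lt_card (α := F)) h1).symm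

theorem cross_ratio_eq (hγ : 2 < (minpoly L γ).natDegree)
    {α β ε₁ ε₂ u₁ u₂ v₁ v₂ : K} (hα : α ≠ 0) (hβ : β ≠ 0)
    (hε₁ : ε₁ ∈ L) (hε₂ : ε₂ ∈ L) (h₁ : ε₁ ≠ 0) (h₂ : ε₂ ≠ 0)
    (hu₁ : u₁ ∈ L) (hu₂ : u₂ ∈ L) (hv₁ : v₁ ∈ L) (hv₂ : v₂ ∈ L) (hu0 : u₂ ≠ 0) (hv0 : v₂ ≠ 0)
    (hx : α * (ε₁ * u₁ + u₁ ^ Nat.card F * γ) = β * (ε₂ * v₁ + v₁ ^ Nat.card F * γ))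
    (hy : α * (ε₁ * u₂ + u₂ ^ Nat.card F * γ) = β * (ε₂ * v₂ + v₂ ^ Nat.card F * γ))
    (hind : u₁ / u₂ ∉ F) :
    ε₁ * (v₂ / u₂) ^ (Nat.card F - 1) = ε₂ := by
  have hq : 1 < Nat.card F := Finite.one_lt_card
  rw [Subfield.mem_iff_pow_natCard] at hind
  obtain ⟨m, hm⟩ : ∃ m, Nat.card F = m + 1 := ⟨Nat.card F - 1, by omega⟩
  set q := Nat.card F with hqdef
  have hprod : α * β * ((ε₁ * u₁ + u₁ ^ q * γ) * (ε₂ * v₂ + v₂ ^ q * γ) -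
      (ε₁ * u₂ + u₂ ^ q * γ) * (ε₂ * v₁ + v₁ ^ q * γ)) = 0 := by
    linear_combination β * (ε₂ * v₂ + v₂ ^ q * γ) * hx - β * (ε₂ * v₁ + v₁ ^ q * γ) * hy
  have hprod' := (mul_eq_zero.1 hprod).resolve_left (mul_ne_zero hα hβ)
  have hpu₁ := pow_mem hu₁ q
  have hpu₂ := pow_mem hu₂ q
  have hpv₁ := pow_mem hv₁ q
  have hpv₂ := pow_mem hv₂ q
  obtain ⟨e0, e1, -⟩ := minpoly.quadratic_coeff_eq_zero hγ
    (a := ε₁ * ε₂ * (u₁ * v₂ - u₂ * v₁))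
    (b := ε₁ * u₁ * v₂ ^ q + ε₂ * u₁ ^ q * v₂ - (ε₁ * u₂ * v₁ ^ q + ε₂ * u₂ ^ q * v₁))
    (c := u₁ ^ q * v₂ ^ q - u₂ ^ q * v₁ ^ q)
    (mul_mem (mul_mem hε₁ hε₂) (sub_mem (mul_mem hu₁ hv₂) (mul_mem hu₂ hv₁)))
    (sub_mem (add_mem (mul_mem (mul_mem hε₁ hu₁) hpv₂) (mul_mem (mul_mem hε₂ hpu₁) hv₂))
      (add_mem (mul_mem (mul_mem hε₁ hu₂) hpv₁) (mul_mem (mul_mem hε₂ hpu₂) hv₁)))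
    (sub_mem (mul_mem hpu₁ hpv₂) (mul_mem hpu₂ hpv₁))
    (by linear_combination hprod')
  have e0' := sub_eq_zero.1 ((mul_eq_zero.1 e0).resolve_left (mul_ne_zero h₁ h₂))
  set t := u₁ / u₂ with ht
  have hu : u₁ = t * u₂ := by rw [ht]; field_simp
  have hv : v₁ = t * v₂ := by
    apply mul_left_cancel₀ hu0
    rw [← e0', hu]; ring
  rw [hu, hv, mul_pow, mul_pow] at e1
  have e2 : (t - t ^ q) * (ε₁ * u₂ * v₂ ^ q - ε₂ * u₂ ^ q * v₂) = 0 := by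
    linear_combination e1
  have e3 := (mul_eq_zero.1 e2).resolve_left (fun h => hind (sub_eq_zero.1 h).symm)
  rw [hm] at e3 ⊢
  rw [Nat.add_sub_cancel, div_pow]
  have hum : u₂ ^ m ≠ 0 := pow_ne_zero _ hu0
  field_simp
  apply mul_left_cancel₀ (mul_ne_zero hu0 hv0)
  linear_combination e3

/-- Two scaled twisted spaces intersect in dimension at most one, unless the parameters differ by
a `(q - 1)`-th power. -/
theorem finrank_inf_le_one_or (h : F ≤ L) (hγ : 2 < (minpoly L γ).natDegree)
    {α β ε₁ ε₂ : K} (hα : α ≠ 0) (hβ : β ≠ 0)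
    (hε₁ : ε₁ ∈ L) (hε₂ : ε₂ ∈ L) (h₁ : ε₁ ≠ 0) (h₂ : ε₂ ≠ 0) :
    Module.finrank F ↥(α • twistedSpace h γ ε₁ ⊓ β • twistedSpace h γ ε₂) ≤ 1 ∨
      ∃ u ∈ L, ∃ v ∈ L, u ≠ 0 ∧ v ≠ 0 ∧ ε₁ * (v / u) ^ (Nat.card F - 1) = ε₂ ∧
        α * (ε₁ * u + u ^ Nat.card F * γ) = β * (ε₂ * v + v ^ Nat.card F * γ) := by
  by_cases hbot : α • twistedSpace h γ ε₁ ⊓ β • twistedSpace h γ ε₂ = ⊥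
  · left
    rw [hbot, finrank_bot]
    exact zero_le_one
  obtain ⟨y, ⟨hyA, hyB⟩, hy0⟩ := Submodule.exists_mem_ne_zero_of_ne_bot hbot
  obtain ⟨u₂, hu₂, hyu⟩ := (mem_smul_twistedSpace h).1 hyA
  obtain ⟨v₂, hv₂, hyv⟩ := (mem_smul_twistedSpace h).1 hyB
  have hq : Nat.card F ≠ 0 := Nat.card_pos.ne'
  have hu0 : u₂ ≠ 0 := by
    rintro rfl
    exact hy0 (by rw [← hyu, zero_pow hq]; ring)
  have hv0 : v₂ ≠ 0 := by
    rintro rfl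
    exact hy0 (by rw [← hyv, zero_pow hq]; ring)
  by_cases hall : ∀ u₁ ∈ L, ∀ v₁ ∈ L, α * (ε₁ * u₁ + u₁ ^ Nat.card F * γ) =
      β * (ε₂ * v₁ + v₁ ^ Nat.card F * γ) → u₁ / u₂ ∈ F
  · left
    refine finrank_le_one ⟨y, hyA, hyB⟩ ?_
    rintro ⟨x, hxA, hxB⟩
    obtain ⟨u₁, hu₁, hxu⟩ := (mem_smul_twistedSpace h).1 hxA
    obtain ⟨v₁, hv₁, hxv⟩ := (mem_smul_twistedSpace h).1 hxB
    have hc := hall u₁ hu₁ v₁ hv₁ (hxu.trans hxv.symm)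
    refine ⟨⟨u₁ / u₂, hc⟩, Subtype.ext ?_⟩
    change u₁ / u₂ * y = x
    have hcq := Subfield.pow_natCard_of_mem hc
    have hu : u₁ = u₁ / u₂ * u₂ := by field_simp
    rw [← hxu, ← hyu]
    conv_rhs => rw [hu, mul_pow, hcq]
    ring
  · right
    push Not at hall
    obtain ⟨u₁, hu₁, v₁, hv₁, he, hn⟩ := hall
    exact ⟨u₂, hu₂, v₂, hv₂, hu0, hv0,
      cross_ratio_eq hγ hα hβ hε₁ hε₂ h₁ h₂ hu₁ hu₂ hv₁ hv₂ hu0 hv0 he (hyu.trans hyv.symm) hn,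
      hyu.trans hyv.symm⟩

theorem finrank_inf_le_one_or_div_mem (h : F ≤ L) (hγ : 2 < (minpoly L γ).natDegree)
    {α β ε : K} (hα : α ≠ 0) (hβ : β ≠ 0) (hε : ε ∈ L) (h0 : ε ≠ 0) :
    Module.finrank F ↥(α • twistedSpace h γ ε ⊓ β • twistedSpace h γ ε) ≤ 1 ∨ α / β ∈ F := by
  refine (finrank_inf_le_one_or h hγ hα hβ hε hε h0 h0).imp_right ?_
  rintro ⟨u, hu, v, hv, hu0, hv0, hpow, he⟩
  have hq : 1 < Nat.card F := Finite.one_lt_card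
  have hone : (v / u) ^ (Nat.card F - 1) = 1 := mul_left_cancel₀ h0 (by rw [hpow, mul_one])
  have hx : (v / u) ^ Nat.card F = v / u := by
    rw [← Nat.sub_add_cancel hq.le, pow_succ, hone, one_mul]
  have hmem : v / u ∈ F := Subfield.mem_iff_pow_natCard.2 hx
  have hne : ε * u + u ^ Nat.card F * γ ≠ 0 := fun h' => hu0 <|
    twistedMap_eq_zero (F := F) hγ hε hu (by rw [twistedMap_apply, h'])
  have hvu : v = v / u * u := by field_simp
  rw [hvu, mul_pow, hx] at he
  have : α = β * (v / u) := mul_right_cancel₀ hne (by linear_combination he)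
  rwa [this, mul_div_cancel_left₀ _ hβ]

theorem smul_twistedSpace_eq_iff [Finite K] (h : F ≤ L) (hγ : 2 < (minpoly L γ).natDegree)
    {k : ℕ} (hk : 2 ≤ k) (hL : Nat.card L = Nat.card F ^ k)
    {α β ε : K} (hα : α ≠ 0) (hβ : β ≠ 0) (hε : ε ∈ L) (h0 : ε ≠ 0) :
    α • twistedSpace h γ ε = β • twistedSpace h γ ε ↔ α / β ∈ F := by
  constructor
  · intro he
    refine (finrank_inf_le_one_or_div_mem h hγ hα hβ hε h0).resolve_left ?_
    rw [he, inf_idem, finrank_smul_twistedSpace h hγ hL hβ hε]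
    omega
  · intro hmem
    have := Submodule.smul_eq_self_of_mem hmem (div_ne_zero hα hβ) (twistedSpace h γ ε)
    calc α • twistedSpace h γ ε = β • (α / β) • twistedSpace h γ ε := by
          rw [← mul_smul, mul_div_cancel₀ _ hβ]
      _ = β • twistedSpace h γ ε := by rw [this]

theorem natCard_orbit_twistedSpace [Finite K] (h : F ≤ L) (hγ : 2 < (minpoly L γ).natDegree)
    {k : ℕ} (hk : 2 ≤ k) (hL : Nat.card L = Nat.card F ^ k)
    {ε : K} (hε : ε ∈ L) (h0 : ε ≠ 0) :
    {W | ∃ α : K, α ≠ 0 ∧ W = α • twistedSpace h γ ε}.ncard =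
      (Nat.card K - 1) / (Nat.card F - 1) := by
  have horb : {W | ∃ α : K, α ≠ 0 ∧ W = α • twistedSpace h γ ε} =
      MulAction.orbit Kˣ (twistedSpace h γ ε) := by
    ext W
    constructor
    · rintro ⟨α, hα, rfl⟩
      exact ⟨Units.mk0 α hα, rfl⟩
    · rintro ⟨α, rfl⟩
      exact ⟨α, α.ne_zero, rfl⟩
  have hstab : MulAction.stabilizer Kˣ (twistedSpace h γ ε) =
      (Units.map (F.subtype : F →* K)).range := by
    ext α
    have h1 := smul_twistedSpace_eq_iff h hγ hk hL α.ne_zero one_ne_zero hε h0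
    rw [one_smul, div_one] at h1
    rw [MulAction.mem_stabilizer_iff]
    refine h1.trans ⟨fun hm => ?_, ?_⟩
    · exact ⟨Units.mk0 ⟨α, hm⟩ (fun h' => α.ne_zero (congrArg Subtype.val h')), Units.ext rfl⟩
    · rintro ⟨c, rfl⟩
      exact c.1.2
  have hcard : Nat.card (MulAction.stabilizer Kˣ (twistedSpace h γ ε)) = Nat.card F - 1 := by
    rw [hstab, ← Nat.card_units]
    exact Nat.card_range_of_injective (Units.map_injective Subtype.val_injective)
  have hmul := Subgroup.card_mul_index (MulAction.stabilizer Kˣ (twistedSpace h γ ε))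
  rw [MulAction.index_stabilizer, hcard, Nat.card_units] at hmul
  have hq : 1 < Nat.card F := Finite.one_lt_card
  rw [horb, ← hmul, Nat.mul_div_cancel_left _ (by omega)]

end TwistedSpace

/-- For `k ∣ n`, `k ≥ 2`, `γ` of degree `n/k > 2` over `F_{q^k}`, and
`δ ∈ F_{q^k}` not a `(q-1)`-th power in `F_{q^k}`, with `U = {u + uᑫγ : u ∈ F_{q^k}}` and
`V = {δv + vᑫγ : v ∈ F_{q^k}}`, the collection `C = {αU : α ≠ 0} ∪ {βV : β ≠ 0}` has
cardinality `2(qⁿ-1)/(q-1)` and minimum subspace distance `2k - 2`. -/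
theorem combined_code_two_orbits {K : Type*} [Field K] (q n k : ℕ)
    (hq : IsPrimePow q) (hn : 0 < n) (hk : 2 ≤ k) (hkn : k ∣ n)
    (hK : Nat.card K = q ^ n)
    (F : Subfield K) (hF : Nat.card F = q)
    (Fk : Subfield K) (hFk : Nat.card Fk = q ^ k) (hFFk : F ≤ Fk)
    (γ : K) (hγ : γ ≠ 0)
    (hdeg : (minpoly Fk γ).natDegree = n / k) (hdeg2 : 2 < n / k)
    (δ : K) (hδ : δ ∈ Fk) (hδpow : ∀ x ∈ Fk, x ^ (q - 1) ≠ δ)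
    (U V : Submodule F K)
    (hU : U = Submodule.span F {x : K | ∃ u ∈ Fk, x = u + u ^ q * γ})
    (hV : V = Submodule.span F {x : K | ∃ v ∈ Fk, x = δ * v + v ^ q * γ})
    (C : Set (Submodule F K))
    (hC : C = {W | ∃ α : K, α ≠ 0 ∧ W = α • U} ∪ {W | ∃ β : K, β ≠ 0 ∧ W = β • V}) :
    Nat.card C = 2 * ((q ^ n - 1) / (q - 1)) ∧ HasMinDist F C (2 * k - 2) := by
  have hq1 : 1 < q := hq.one_lt
  have : Finite F := Nat.finite_of_card_ne_zero (by omega)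
  have : Finite K := Nat.finite_of_card_ne_zero (by rw [hK]; positivity)
  subst hF
  have hγ2 : 2 < (minpoly Fk γ).natDegree := hdeg ▸ hdeg2
  have hδ0 : δ ≠ 0 := by
    rintro rfl
    by_cases h2 : Nat.card F - 1 = 0
    · omega
    · exact hδpow 0 Fk.zero_mem (zero_pow h2)
  replace hU : U = twistedSpace hFFk γ 1 := by
    rw [hU, ← span_twisted_eq]
    simp only [one_mul]
  replace hV : V = twistedSpace hFFk γ δ := by rw [hV, ← span_twisted_eq]
  subst hU hV
  have hUV : ∀ α β : K, α ≠ 0 → β ≠ 0 → Module.finrank F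
      ↥(α • twistedSpace hFFk γ 1 ⊓ β • twistedSpace hFFk γ δ) ≤ 1 := by
    intro α β hα hβ
    refine (finrank_inf_le_one_or hFFk hγ2 hα hβ Fk.one_mem hδ one_ne_zero hδ0).resolve_right ?_
    rintro ⟨u, hu, v, hv, -, -, hpow, -⟩
    exact hδpow (v / u) (Fk.div_mem hv hu) (by rw [← hpow, one_mul])
  have hself : ∀ ε ∈ Fk, ε ≠ 0 → ∀ α β : K, α ≠ 0 → β ≠ 0 →
      α • twistedSpace hFFk γ ε ≠ β • twistedSpace hFFk γ ε → Module.finrank F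
      ↥(α • twistedSpace hFFk γ ε ⊓ β • twistedSpace hFFk γ ε) ≤ 1 := by
    intro ε hε h0 α β hα hβ hne
    refine (finrank_inf_le_one_or_div_mem hFFk hγ2 hα hβ hε h0).resolve_right fun hm => hne ?_
    exact (smul_twistedSpace_eq_iff hFFk hγ2 hk hFk hα hβ hε h0).2 hm
  have hrank : ∀ A ∈ C, Module.finrank F A = k := by
    rw [hC]
    rintro A (⟨α, hα, rfl⟩ | ⟨α, hα, rfl⟩)
    · exact finrank_smul_twistedSpace hFFk hγ2 hFk hα Fk.one_mem
    · exact finrank_smul_twistedSpace hFFk hγ2 hFk hα hδ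
  have hinf : ∀ A ∈ C, ∀ B ∈ C, A ≠ B → Module.finrank F ↥(A ⊓ B) ≤ 1 := by
    rw [hC]
    rintro A (⟨α, hα, rfl⟩ | ⟨α, hα, rfl⟩) B (⟨β, hβ, rfl⟩ | ⟨β, hβ, rfl⟩) hne
    · exact hself 1 Fk.one_mem one_ne_zero α β hα hβ hne
    · exact hUV α β hα hβ
    · rw [inf_comm]
      exact hUV β α hβ hα
    · exact hself δ hδ hδ0 α β hα hβ hne
  refine ⟨?_, ?_, ?_⟩
  · rw [Nat.card_coe_set_eq, hC, Set.ncard_union_eq ?_ (Set.toFinite _) (Set.toFinite _),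
      natCard_orbit_twistedSpace hFFk hγ2 hk hFk Fk.one_mem one_ne_zero,
      natCard_orbit_twistedSpace hFFk hγ2 hk hFk hδ hδ0, hK]
    · ring
    · rw [Set.disjoint_left]
      rintro W ⟨α, hα, rfl⟩ ⟨β, hβ, he⟩
      have h1 := hUV α β hα hβ
      rw [← he, inf_idem, finrank_smul_twistedSpace hFFk hγ2 hFk hα Fk.one_mem] at h1
      omega
  · obtain ⟨u, hu, huF⟩ : ∃ u ∈ Fk, u ∉ F := by
      by_contra! hle
      have h1 : Nat.card Fk = Nat.card F := by rw [le_antisymm hle hFFk]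
      rw [hFk] at h1
      have := Nat.pow_right_injective hq1 (h1.trans (pow_one _).symm)
      omega
    have hne : ∀ w ∈ Fk, w ≠ 0 → 1 * w + w ^ Nat.card F * γ ≠ 0 := fun w hw hw0 h' => hw0 <|
      twistedMap_eq_zero (F := F) hγ2 Fk.one_mem hw (by rw [twistedMap_apply, h'])
    have hu0 : u ≠ 0 := fun h' => huF (h' ▸ F.zero_mem)
    set a := 1 * u + u ^ Nat.card F * γ with ha
    set b := 1 * (1 : K) + 1 ^ Nat.card F * γ with hb
    have ha0 : a ≠ 0 := hne u hu hu0
    have hb0 : b ≠ 0 := hne 1 Fk.one_mem one_ne_zero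
    have hab : a / b ∉ F := by
      intro hm
      have h1 : twistedMap F γ 1 (u - a / b) = 0 := by
        have h2 : twistedMap F γ 1 (a / b) = a / b * b := by
          rw [twistedMap_apply, Subfield.pow_natCard_of_mem hm, hb, one_pow]
          ring
        rw [map_sub, h2, twistedMap_apply, ← ha, div_mul_cancel₀ _ hb0, sub_self]
      have h3 := twistedMap_eq_zero hγ2 Fk.one_mem (Fk.sub_mem hu (hFFk hm)) h1
      exact huF (sub_eq_zero.1 h3 ▸ hm)
    have hA : (a / b) • twistedSpace hFFk γ 1 ∈ C := by
      rw [hC]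
      exact Or.inl ⟨_, div_ne_zero ha0 hb0, rfl⟩
    have hB : (1 : K) • twistedSpace hFFk γ 1 ∈ C := by
      rw [hC]
      exact Or.inl ⟨_, one_ne_zero, rfl⟩
    have hAB : (a / b) • twistedSpace hFFk γ 1 ≠ (1 : K) • twistedSpace hFFk γ 1 := by
      rw [Ne, smul_twistedSpace_eq_iff hFFk hγ2 hk hFk (div_ne_zero ha0 hb0) one_ne_zero
        Fk.one_mem one_ne_zero, div_one]
      exact hab
    refine ⟨_, hA, _, hB, hAB, ?_⟩
    have hle := hinf _ hA _ hB hAB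
    have hmem : a ∈ (a / b) • twistedSpace hFFk γ 1 ⊓ (1 : K) • twistedSpace hFFk γ 1 :=
      ⟨(mem_smul_twistedSpace hFFk).2 ⟨1, Fk.one_mem, by rw [← hb, div_mul_cancel₀ _ hb0]⟩,
        (mem_smul_twistedSpace hFFk).2 ⟨u, hu, by rw [← ha, one_mul]⟩⟩
    have hpos : Module.finrank F
        ↥((a / b) • twistedSpace hFFk γ 1 ⊓ (1 : K) • twistedSpace hFFk γ 1) ≠ 0 := by
      rw [Ne, Submodule.finrank_eq_zero]
      intro hbot
      rw [hbot] at hmem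
      exact ha0 hmem
    rw [subspaceDist, hrank _ hA, hrank _ hB]
    omega
  · rintro e ⟨A, hA, B, hB, hne, rfl⟩
    have h1 := hinf A hA B hB hne
    rw [subspaceDist, hrank A hA, hrank B hB]
    omega
end

section
/- Let n, k be positive integers with k | n, k odd, and k ≥ 3. Let γ ∈ F_{3^n}^* be a root of an irreducible polynomial of degree n/k over F_{3^k}, where n/k > 2. Set U = {u + u^3 γ : u ∈ F_{3^k}} and V = {v − v^3 γ : v ∈ F_{3^k}}. Then the collection C = {αU : α ∈ F_{3^n}^*} ∪ {βV : β ∈ F_{3^n}^*} of F_3-subspaces of F_{3^n} has cardinality 3^n − 1 and minimum subspace distance 2k − 2. -/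
open Submodule Pointwise

set_option maxHeartbeats 1000000
set_option synthInstance.maxHeartbeats 400000

/-- The `F`-span of `{u + e u³ g : u ∈ L}`. -/
def cubicTwist {K : Type*} [Field K] (F L : Subfield K) (e g : K) : Submodule F K :=
  Submodule.span F {x : K | ∃ u ∈ L, x = u + e * (u ^ 3 * g)}

section CubicTwist

variable {K : Type*} [Field K] {F L : Subfield K} {e e' g : K} {k : ℕ}

theorem three_eq_zero_of_card (hF : Nat.card F = 3) : (3 : K) = 0 := by
  have h := card_nsmul_eq_zero' (x := (1 : F))
  rw [hF, nsmul_eq_mul, mul_one] at h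
  exact congrArg Subtype.val h

theorem pow_card_of_mem {q : ℕ} (hq : q ≠ 0) (hL : Nat.card L = q) {x : K} (hx : x ∈ L) :
    x ^ q = x := by
  have : Finite L := Nat.finite_of_card_ne_zero (by omega)
  have := Fintype.ofFinite L
  have h := FiniteField.pow_card (⟨x, hx⟩ : L)
  rw [← Nat.card_eq_fintype_card, hL] at h
  simpa using congrArg Subtype.val h

theorem mem_cubicTwist (hF : Nat.card F = 3) (hFL : F ≤ L) {x : K} :
    x ∈ cubicTwist F L e g ↔ ∃ u ∈ L, x = u + e * (u ^ 3 * g) := by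
  refine ⟨fun hx => ?_, fun hx => Submodule.subset_span hx⟩
  have h3 := three_eq_zero_of_card hF
  induction hx using Submodule.span_induction with
  | mem x h => exact h
  | zero => exact ⟨0, L.zero_mem, by simp⟩
  | add x y _ _ hx hy =>
    obtain ⟨u, hu, rfl⟩ := hx
    obtain ⟨v, hv, rfl⟩ := hy
    exact ⟨u + v, L.add_mem hu hv, by linear_combination (-e * g * (u ^ 2 * v + u * v ^ 2)) * h3⟩
  | smul a x _ hx =>
    obtain ⟨u, hu, rfl⟩ := hx
    refine ⟨a * u, L.mul_mem (hFL a.2) hu, ?_⟩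
    have ha := pow_card_of_mem (by norm_num) hF a.2
    rw [Subfield.smul_def, smul_eq_mul]
    linear_combination (-e * u ^ 3 * g) * ha

theorem coeffs_eq_zero (hg : 2 < (minpoly L g).natDegree) {a b c : K} (ha : a ∈ L) (hb : b ∈ L)
    (hc : c ∈ L) (h : a + b * g + c * g ^ 2 = 0) : a = 0 ∧ b = 0 ∧ c = 0 := by
  let p : Polynomial L := Polynomial.C ⟨c, hc⟩ * Polynomial.X ^ 2 +
    Polynomial.C ⟨b, hb⟩ * Polynomial.X + Polynomial.C ⟨a, ha⟩
  have hp : Polynomial.aeval g p = 0 := by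
    simp only [p, map_add, map_mul, map_pow, Polynomial.aeval_C, Polynomial.aeval_X]
    change c * g ^ 2 + b * g + a = 0
    linear_combination h
  have hp0 : p = 0 := by
    by_contra hne
    have h1 := Polynomial.natDegree_le_natDegree (minpoly.degree_le_of_ne_zero L g hne hp)
    have h2 : p.natDegree ≤ 2 := Polynomial.natDegree_quadratic_le
    omega
  have h0 := congrArg (fun r => Polynomial.coeff r 0) hp0
  have h1 := congrArg (fun r => Polynomial.coeff r 1) hp0
  have h2 := congrArg (fun r => Polynomial.coeff r 2) hp0
  simp [p, Polynomial.coeff_X, Polynomial.coeff_C] at h0 h1 h2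
  exact ⟨congrArg Subtype.val h0, congrArg Subtype.val h1, congrArg Subtype.val h2⟩

theorem sq_ne_neg_one_of_card (h3 : (3 : K) = 0) (hk : Odd k) (hL : Nat.card L = 3 ^ k) {x : K}
    (hx : x ∈ L) : x ^ 2 ≠ -1 := by
  intro h
  have hpow := pow_card_of_mem (by positivity) hL hx
  obtain ⟨m, rfl⟩ := hk
  have h4 : (3 ^ (2 * m + 1)) % 4 = 3 := by
    rw [pow_succ, pow_mul, Nat.mul_mod, Nat.pow_mod]; norm_num
  have hx4 : x ^ 4 = 1 := by linear_combination (x ^ 2 - 1) * h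
  rw [← Nat.div_add_mod (3 ^ (2 * m + 1)) 4, h4, pow_add, pow_mul, hx4, one_pow, one_mul] at hpow
  have hx0 : x = 0 := by linear_combination hpow - x * h + x * h3
  simp [hx0] at h

theorem cubicTwist_injOn (hg : 2 < (minpoly L g).natDegree) (he : e ∈ L) :
    Set.InjOn (fun u : K => u + e * (u ^ 3 * g)) L := by
  intro u hu v hv h
  have := (coeffs_eq_zero hg (L.sub_mem hu hv)
    (L.mul_mem he (L.sub_mem (L.pow_mem hu 3) (L.pow_mem hv 3))) L.zero_mem
    (by simp only at h; linear_combination h)).1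
  linear_combination this

theorem finrank_smul_cubicTwist (hF : Nat.card F = 3) (hFL : F ≤ L) (hL : Nat.card L = 3 ^ k)
    (hg : 2 < (minpoly L g).natDegree) (he : e ∈ L) {a : K} (ha : a ≠ 0) :
    Module.finrank F ↥(a • cubicTwist F L e g) = k := by
  have hset : ((a • cubicTwist F L e g : Submodule F K) : Set K) =
      (fun x => a * x) '' ((fun u : K => u + e * (u ^ 3 * g)) '' L) := by
    ext x
    rw [Submodule.coe_pointwise_smul]
    simp only [Set.mem_smul_set, Set.mem_image, SetLike.mem_coe, mem_cubicTwist hF hFL, smul_eq_mul]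
    constructor
    · rintro ⟨_, ⟨u, hu, rfl⟩, rfl⟩
      exact ⟨_, ⟨u, hu, rfl⟩, rfl⟩
    · rintro ⟨_, ⟨u, hu, rfl⟩, rfl⟩
      exact ⟨_, ⟨u, hu, rfl⟩, rfl⟩
  have hcard : Nat.card ↥(a • cubicTwist F L e g) = 3 ^ k := by
    rw [← hL]
    change Nat.card ((a • cubicTwist F L e g : Submodule F K) : Set K) = Nat.card (L : Set K)
    rw [hset, Nat.card_image_of_injective (mul_right_injective₀ ha),
      Nat.card_image_of_injOn (cubicTwist_injOn hg he)]
  have : Finite ↥(a • cubicTwist F L e g) :=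
    Nat.finite_of_card_ne_zero (by rw [hcard]; positivity)
  have hp := Module.natCard_eq_pow_finrank (K := F) (V := ↥(a • cubicTwist F L e g))
  rw [hcard, hF] at hp
  exact (Nat.pow_right_injective (by norm_num) hp).symm

theorem ratio_of_mem_two_smul_cubicTwist (hF : Nat.card F = 3) (hFL : F ≤ L)
    (hg : 2 < (minpoly L g).natDegree) (he : e ∈ L) (he' : e' ∈ L) {a b x y : K}
    (ha : a ≠ 0) (hb : b ≠ 0) (hx0 : x ≠ 0)
    (hxa : x ∈ a • cubicTwist F L e g) (hxb : x ∈ b • cubicTwist F L e' g)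
    (hya : y ∈ a • cubicTwist F L e g) (hyb : y ∈ b • cubicTwist F L e' g) :
    (y = 0 ∨ y = x ∨ y = -x) ∨
      ∃ l ∈ L, e' * l ^ 2 = e ∧ (e = e' → l ^ 2 = 1 → a = b * l) := by
  rw [Submodule.mem_smul_pointwise_iff_exists] at hxa hxb hya hyb
  simp only [mem_cubicTwist hF hFL, smul_eq_mul] at hxa hxb hya hyb
  obtain ⟨_, ⟨u, hu, rfl⟩, hxu⟩ := hxa
  obtain ⟨_, ⟨w, hw, rfl⟩, hxw⟩ := hxb
  obtain ⟨_, ⟨u', hu', rfl⟩, hyu⟩ := hya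
  obtain ⟨_, ⟨w', hw', rfl⟩, hyw⟩ := hyb
  have hu0 : u ≠ 0 := by rintro rfl; apply hx0; rw [← hxu]; ring
  have hw0 : w ≠ 0 := by rintro rfl; apply hx0; rw [← hxw]; ring
  have hcross : (u + e * (u ^ 3 * g)) * (w' + e' * (w' ^ 3 * g)) =
      (u' + e * (u' ^ 3 * g)) * (w + e' * (w ^ 3 * g)) := by
    apply mul_left_cancel₀ (mul_ne_zero ha hb)
    calc _ = (a * (u + e * (u ^ 3 * g))) * (b * (w' + e' * (w' ^ 3 * g))) := by ring
      _ = (a * (u' + e * (u' ^ 3 * g))) * (b * (w + e' * (w ^ 3 * g))) := by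
        rw [hxu, hxw, hyu, hyw, mul_comm]
      _ = _ := by ring
  obtain ⟨h1, h2, -⟩ := coeffs_eq_zero (a := u * w' - u' * w)
    (b := e' * (u * w' ^ 3 - u' * w ^ 3) + e * (u ^ 3 * w' - u' ^ 3 * w))
    (c := e * e' * (u ^ 3 * w' ^ 3 - u' ^ 3 * w ^ 3)) hg
    (by clear hFL; apply_rules [L.sub_mem, L.mul_mem])
    (by clear hFL; apply_rules [L.add_mem, L.sub_mem, L.mul_mem, L.pow_mem])
    (by clear hFL; apply_rules [L.sub_mem, L.mul_mem, L.pow_mem]) (by linear_combination hcross)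
  obtain ⟨l, hl, rfl⟩ : ∃ l ∈ L, w = l * u :=
    ⟨w / u, L.div_mem hw hu, by field_simp⟩
  have hl0 : l ≠ 0 := left_ne_zero_of_mul hw0
  obtain rfl : w' = l * u' := by
    apply mul_left_cancel₀ hu0
    linear_combination h1
  have hprod : l * (e' * l ^ 2 - e) * (u * u' * ((u' - u) * (u' + u))) = 0 := by
    linear_combination h2
  simp only [mul_eq_zero, hl0, hu0, false_or] at hprod
  rcases hprod with h | h | h | h
  · refine Or.inr ⟨l, hl, sub_eq_zero.1 h, ?_⟩
    rintro rfl hl2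
    have hne : u + e * (u ^ 3 * g) ≠ 0 := right_ne_zero_of_mul (hxu ▸ hx0)
    apply mul_right_cancel₀ hne
    linear_combination hxu - hxw + b * l * e * u ^ 3 * g * hl2
  · exact Or.inl (Or.inl (by rw [← hyu, h]; ring))
  · obtain rfl := sub_eq_zero.1 h
    exact Or.inl (Or.inr (Or.inl (by rw [← hyu, hxu])))
  · obtain rfl := eq_neg_of_add_eq_zero_left h
    exact Or.inl (Or.inr (Or.inr (by rw [← hyu, ← hxu]; ring)))

theorem finrank_inf_smul_cubicTwist_le_one (hF : Nat.card F = 3) (hFL : F ≤ L)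
    (hL : Nat.card L = 3 ^ k) (hk : Odd k) (hg : 2 < (minpoly L g).natDegree)
    (he : e = 1 ∨ e = -1) (he' : e' = 1 ∨ e' = -1) {a b : K} (ha : a ≠ 0) (hb : b ≠ 0) :
    Module.finrank F ↥(a • cubicTwist F L e g ⊓ b • cubicTwist F L e' g) ≤ 1 ∨
      (e = e' ∧ (a = b ∨ a = -b)) := by
  have hmem : ∀ {c : K}, c = 1 ∨ c = -1 → c ∈ L := by
    rintro c (rfl | rfl)
    exacts [L.one_mem, L.neg_mem L.one_mem]
  by_contra! hcon
  obtain ⟨hrank, hne⟩ := hcon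
  have hnt := Module.nontrivial_of_finrank_pos (R := F) (zero_lt_one.trans hrank)
  obtain ⟨⟨x, hxa, hxb⟩, hx0⟩ := exists_ne
    (0 : ↥(a • cubicTwist F L e g ⊓ b • cubicTwist F L e' g))
  have hx : x ≠ 0 := fun h => hx0 (Subtype.ext h)
  refine absurd (finrank_le_one (⟨x, hxa, hxb⟩ :
    ↥(a • cubicTwist F L e g ⊓ b • cubicTwist F L e' g)) ?_) (not_le.2 hrank)
  rintro ⟨y, hya, hyb⟩
  rcases ratio_of_mem_two_smul_cubicTwist hF hFL hg (hmem he) (hmem he') ha hb hx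
    hxa hxb hya hyb with (rfl | rfl | rfl) | ⟨l, hl, hll, hab⟩
  · exact ⟨0, Subtype.ext (by simp)⟩
  · exact ⟨1, Subtype.ext (by simp)⟩
  · exact ⟨-1, Subtype.ext (by simp)⟩
  · exfalso
    have hsq : l ^ 2 = 1 := by
      have := sq_ne_neg_one_of_card (three_eq_zero_of_card hF) hk hL hl
      rcases he with rfl | rfl <;> rcases he' with rfl | rfl
      · linear_combination hll
      · exact absurd (by linear_combination -hll) this
      · exact absurd (by linear_combination hll) this
      · linear_combination -hll
    have hee : e = e' := by rw [← hll, hsq, mul_one]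
    have hl1 := hab hee hsq
    rcases sq_eq_sq_iff_eq_or_eq_neg.1 (hsq.trans (one_pow 2).symm) with rfl | rfl
    · exact (hne hee).1 (by simpa using hl1)
    · exact (hne hee).2 (by simpa using hl1)

theorem orbit_eq_setOf_smul (W : Submodule F K) :
    {X | ∃ a : K, a ≠ 0 ∧ X = a • W} = MulAction.orbit Kˣ W := by
  ext X
  constructor
  · rintro ⟨a, ha, rfl⟩
    exact ⟨Units.mk0 a ha, rfl⟩
  · rintro ⟨a, rfl⟩
    exact ⟨a, a.ne_zero, rfl⟩

theorem two_mul_ncard_orbit_cubicTwist [Finite K] (hF : Nat.card F = 3) (hFL : F ≤ L)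
    (hL : Nat.card L = 3 ^ k) (hk : Odd k) (hk1 : 1 < k) (hg : 2 < (minpoly L g).natDegree)
    (he : e = 1 ∨ e = -1) :
    2 * {X | ∃ a : K, a ≠ 0 ∧ X = a • cubicTwist F L e g}.ncard = Nat.card K - 1 := by
  have heL : e ∈ L := by
    rcases he with rfl | rfl
    exacts [L.one_mem, L.neg_mem L.one_mem]
  have hstab : (MulAction.stabilizer Kˣ (cubicTwist F L e g) : Set Kˣ) = {1, -1} := by
    ext a
    simp only [SetLike.mem_coe, MulAction.mem_stabilizer_iff, Set.mem_insert_iff,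
      Set.mem_singleton_iff]
    constructor
    · intro h
      have h' : (a : K) • cubicTwist F L e g = (1 : K) • cubicTwist F L e g := by
        rw [one_smul]; exact h
      rcases finrank_inf_smul_cubicTwist_le_one hF hFL hL hk hg he he a.ne_zero
        (one_ne_zero (α := K)) with h1 | ⟨-, h1⟩
      · rw [h', inf_idem, finrank_smul_cubicTwist hF hFL hL hg heL one_ne_zero] at h1
        omega
      · exact h1.imp (fun h => Units.ext h) (fun h => Units.ext (by simpa using h))
    · rintro (rfl | rfl)
      · exact one_smul _ _
      · ext x
        constructor
        · rintro ⟨y, hy, rfl⟩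
          simpa using hy
        · intro hx
          exact ⟨-x, Submodule.neg_mem _ hx, by simp⟩
  have hne : (1 : Kˣ) ≠ -1 := by
    intro h
    have h1 : (1 : K) = -1 := by simpa using congrArg Units.val h
    exact one_ne_zero (α := K) (by linear_combination three_eq_zero_of_card hF - h1)
  have hcard := MulAction.orbitEquivQuotientStabilizer Kˣ (cubicTwist F L e g)
  have h2 : Nat.card (MulAction.stabilizer Kˣ (cubicTwist F L e g)) = 2 := by
    change Nat.card (MulAction.stabilizer Kˣ (cubicTwist F L e g) : Set Kˣ) = 2
    rw [hstab, Nat.card_coe_set_eq, Set.ncard_pair hne]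
  rw [orbit_eq_setOf_smul, ← Nat.card_coe_set_eq, Nat.card_congr hcard, ← Nat.card_units, ← h2,
    mul_comm]
  exact (Subgroup.card_eq_card_quotient_mul_card_subgroup _).symm

end CubicTwist

/-- Over `F_3`, for `k ∣ n` with `k` odd, `k ≥ 3`, and `γ` of degree
`n/k > 2` over `F_{3^k}`, with `U = {u + u³γ : u ∈ F_{3^k}}` and
`V = {v - v³γ : v ∈ F_{3^k}}`, the collection `C = {αU : α ≠ 0} ∪ {βV : β ≠ 0}` has
cardinality `3ⁿ - 1` and minimum subspace distance `2k - 2`. -/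
theorem combined_code_char_three {K : Type*} [Field K] (n k : ℕ)
    (hn : 0 < n) (hk : 3 ≤ k) (hkodd : Odd k) (hkn : k ∣ n)
    (hK : Nat.card K = 3 ^ n)
    (F : Subfield K) (hF : Nat.card F = 3)
    (Fk : Subfield K) (hFk : Nat.card Fk = 3 ^ k) (hFFk : F ≤ Fk)
    (γ : K) (hγ : γ ≠ 0)
    (hdeg : (minpoly Fk γ).natDegree = n / k) (hdeg2 : 2 < n / k)
    (U V : Submodule F K)
    (hU : U = Submodule.span F {x : K | ∃ u ∈ Fk, x = u + u ^ 3 * γ})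
    (hV : V = Submodule.span F {x : K | ∃ v ∈ Fk, x = v - v ^ 3 * γ})
    (C : Set (Submodule F K))
    (hC : C = {W | ∃ α : K, α ≠ 0 ∧ W = α • U} ∪ {W | ∃ β : K, β ≠ 0 ∧ W = β • V}) :
    Nat.card C = 3 ^ n - 1 ∧ HasMinDist F C (2 * k - 2) := by
  have hg : 2 < (minpoly Fk γ).natDegree := hdeg ▸ hdeg2
  have hUt : U = cubicTwist F Fk 1 γ := by simp only [hU, cubicTwist, one_mul]
  have hVt : V = cubicTwist F Fk (-1) γ := by
    simp only [hV, cubicTwist, neg_mul, one_mul, sub_eq_add_neg]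
  clear hU hV
  subst hUt hVt hC
  have hfin : Finite K := Nat.finite_of_card_ne_zero (by rw [hK]; positivity)
  have h1 : (1 : K) ∈ Fk := Fk.one_mem
  have hm1 : (-1 : K) ∈ Fk := Fk.neg_mem h1
  have h3 := three_eq_zero_of_card hF
  have hne : (1 : K) ≠ -1 := fun h => one_ne_zero (α := K) (by linear_combination h3 - h)
  have hC : ∀ W ∈ {W | ∃ α : K, α ≠ 0 ∧ W = α • cubicTwist F Fk 1 γ} ∪
      {W | ∃ β : K, β ≠ 0 ∧ W = β • cubicTwist F Fk (-1) γ},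
      ∃ e a : K, (e = 1 ∨ e = -1) ∧ e ∈ Fk ∧ a ≠ 0 ∧ W = a • cubicTwist F Fk e γ := by
    rintro W (⟨a, ha, rfl⟩ | ⟨a, ha, rfl⟩)
    exacts [⟨1, a, Or.inl rfl, h1, ha, rfl⟩, ⟨-1, a, Or.inr rfl, hm1, ha, rfl⟩]
  refine ⟨?_, ?_, ?_⟩
  · rw [Nat.card_coe_set_eq, Set.ncard_union_eq]
    · have hU2 := two_mul_ncard_orbit_cubicTwist hF hFFk hFk hkodd (by omega) hg
        (Or.inl rfl : (1 : K) = 1 ∨ (1 : K) = -1)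
      have hV2 := two_mul_ncard_orbit_cubicTwist hF hFFk hFk hkodd (by omega) hg
        (Or.inr rfl : (-1 : K) = 1 ∨ (-1 : K) = -1)
      omega
    · rw [Set.disjoint_left]
      rintro _ ⟨a, ha, rfl⟩ ⟨b, hb, hab⟩
      rcases finrank_inf_smul_cubicTwist_le_one hF hFFk hFk hkodd hg
        (Or.inl rfl) (Or.inr rfl) ha hb with h | ⟨h, -⟩
      · rw [← hab, inf_idem, finrank_smul_cubicTwist hF hFFk hFk hg h1 ha] at h
        omega
      · exact hne h
  · have hp : 1 + γ ≠ 0 := fun h => one_ne_zero (α := K)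
      (coeffs_eq_zero hg h1 h1 Fk.zero_mem (by linear_combination h)).1
    have hm : 1 - γ ≠ 0 := fun h => one_ne_zero (α := K)
      (coeffs_eq_zero hg h1 hm1 Fk.zero_mem (by linear_combination h)).1
    have hle := (finrank_inf_smul_cubicTwist_le_one hF hFFk hFk hkodd hg
      (Or.inl rfl) (Or.inr rfl) hm hp).resolve_right (fun h => hne h.1)
    have hrU := finrank_smul_cubicTwist hF hFFk hFk hg h1 hm
    have hrV := finrank_smul_cubicTwist hF hFFk hFk hg hm1 hp
    refine ⟨_, Or.inl ⟨1 - γ, hm, rfl⟩, _, Or.inr ⟨1 + γ, hp, rfl⟩, ?_, ?_⟩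
    · intro h
      rw [← h, inf_idem, hrU] at hle
      omega
    · have hpos : 0 < Module.finrank F
          ↥((1 - γ) • cubicTwist F Fk 1 γ ⊓ (1 + γ) • cubicTwist F Fk (-1) γ) := by
        have hbot : (1 - γ) * (1 + γ) ∈
            (1 - γ) • cubicTwist F Fk 1 γ ⊓ (1 + γ) • cubicTwist F Fk (-1) γ := by
          rw [Submodule.mem_inf, Submodule.mem_smul_pointwise_iff_exists,
            Submodule.mem_smul_pointwise_iff_exists]
          exact ⟨⟨1 + γ, (mem_cubicTwist hF hFFk).2 ⟨1, h1, by ring⟩, rfl⟩,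
            ⟨1 - γ, (mem_cubicTwist hF hFFk).2 ⟨1, h1, by ring⟩, mul_comm _ _⟩⟩
        have : Nontrivial
            ↥((1 - γ) • cubicTwist F Fk 1 γ ⊓ (1 + γ) • cubicTwist F Fk (-1) γ) :=
          ⟨⟨⟨_, hbot⟩, 0, fun h => mul_ne_zero hm hp (congrArg Subtype.val h)⟩⟩
        exact Module.finrank_pos
      rw [subspaceDist, hrU, hrV]
      omega
  · rintro _ ⟨A, hA, B, hB, hAB, rfl⟩
    obtain ⟨e, a, he, heL, ha, rfl⟩ := hC A hA
    obtain ⟨e', b, he', heL', hb, rfl⟩ := hC B hB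
    rcases finrank_inf_smul_cubicTwist_le_one hF hFFk hFk hkodd hg he he' ha hb with
      h | ⟨rfl, rfl | rfl⟩
    · rw [subspaceDist, finrank_smul_cubicTwist hF hFFk hFk hg heL ha,
        finrank_smul_cubicTwist hF hFFk hFk hg heL' hb]
      omega
    · exact absurd rfl hAB
    · refine absurd ?_ hAB
      ext x
      simp only [Submodule.mem_smul_pointwise_iff_exists, smul_eq_mul]
      constructor
      · rintro ⟨y, hy, rfl⟩
        exact ⟨-y, Submodule.neg_mem _ hy, by ring⟩
      · rintro ⟨y, hy, rfl⟩
        exact ⟨-y, Submodule.neg_mem _ hy, by ring⟩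
end

section
/- Let q be a prime power and n, k positive integers with 2 ≤ k ≤ n, and let V be a k-dimensional F_q-subspace of F_{q^n}. Then the orbit code orb(V) = {αV : α ∈ F_{q^n}^*} has cardinality (q^n − 1)/(q − 1) and minimum subspace distance 2k − 2 if and only if V is a Sidon space. -/
open Submodule Pointwise

set_option maxHeartbeats 1000000
set_option synthInstance.maxHeartbeats 400000

section OrbitCode

variable {K : Type*} [Field K] {F : Subfield K}

theorem mem_span_singleton_iff_div_mem {a c : K} (hc : c ≠ 0) :
    a ∈ Submodule.span F {c} ↔ a / c ∈ F := by
  rw [Submodule.mem_span_singleton]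
  constructor
  · rintro ⟨x, rfl⟩
    rw [Subfield.smul_def, smul_eq_mul, mul_div_cancel_right₀ _ hc]
    exact x.2
  · intro h
    exact ⟨⟨a / c, h⟩, by rw [Subfield.smul_def, smul_eq_mul, div_mul_cancel₀ _ hc]⟩

theorem span_singleton_eq_iff_div_mem {a c : K} (ha : a ≠ 0) (hc : c ≠ 0) :
    Submodule.span F {a} = Submodule.span F {c} ↔ a / c ∈ F := by
  constructor
  · intro h
    rw [← mem_span_singleton_iff_div_mem hc, ← h]
    exact Submodule.mem_span_singleton_self a
  · intro h
    apply le_antisymm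
    · rwa [Submodule.span_singleton_le_iff_mem, mem_span_singleton_iff_div_mem hc]
    · rw [Submodule.span_singleton_le_iff_mem, mem_span_singleton_iff_div_mem ha]
      simpa using F.inv_mem h

theorem mem_smul_submodule_iff {α x : K} (hα : α ≠ 0) {V : Submodule F K} :
    x ∈ α • V ↔ α⁻¹ * x ∈ V := by
  rw [Submodule.mem_smul_pointwise_iff_exists]
  constructor
  · rintro ⟨y, hy, rfl⟩
    simpa [hα] using hy
  · intro h
    exact ⟨_, h, by simp [hα]⟩

theorem smul_submodule_eq_self {α : K} (hα : α ≠ 0) (hαF : α ∈ F) (V : Submodule F K) :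
    α • V = V := by
  ext x
  rw [mem_smul_submodule_iff hα]
  constructor
  · intro h
    simpa [Subfield.smul_def, hα] using V.smul_mem (⟨α, hαF⟩ : F) h
  · intro h
    exact V.smul_mem (⟨α⁻¹, F.inv_mem hαF⟩ : F) h

theorem finrank_smul_submodule {α : K} (hα : α ≠ 0) (V : Submodule F K) :
    Module.finrank F ↥(α • V) = Module.finrank F V :=
  (LinearEquiv.finrank_eq (Submodule.equivMapOfInjective
    (DistribSMul.toLinearMap F K α) (mul_right_injective₀ hα) V)).symm

theorem smul_inf_smul {α β : K} (hα : α ≠ 0) (hβ : β ≠ 0) (V : Submodule F K) :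
    α • V ⊓ β • V = α • (V ⊓ (α⁻¹ * β) • V) := by
  ext x
  simp only [Submodule.mem_inf, mem_smul_submodule_iff hα, mem_smul_submodule_iff hβ,
    mem_smul_submodule_iff (mul_ne_zero (inv_ne_zero hα) hβ)]
  have h : (α⁻¹ * β)⁻¹ * (α⁻¹ * x) = β⁻¹ * x := by field_simp
  rw [h]

theorem subspaceDist_smul_smul {α β : K} (hα : α ≠ 0) (hβ : β ≠ 0) (V : Submodule F K) :
    subspaceDist F (α • V) (β • V) =
      2 * Module.finrank F V - 2 * Module.finrank F ↥(V ⊓ (α⁻¹ * β) • V) := by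
  rw [subspaceDist, smul_inf_smul hα hβ, finrank_smul_submodule hα, finrank_smul_submodule hβ,
    finrank_smul_submodule hα, two_mul (Module.finrank F V)]

theorem finrank_le_one_of_div_mem {W : Submodule F K}
    (h : ∀ a ∈ W, ∀ b ∈ W, a ≠ 0 → b ≠ 0 → a / b ∈ F) : Module.finrank F W ≤ 1 := by
  by_cases hW : ∃ b ∈ W, b ≠ 0
  · obtain ⟨b, hbW, hb⟩ := hW
    refine finrank_le_one ⟨b, hbW⟩ fun w => ?_
    by_cases hw : (w : K) = 0
    · exact ⟨0, Subtype.ext (by simp [hw])⟩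
    · obtain ⟨c, hc⟩ := Submodule.mem_span_singleton.1
        ((mem_span_singleton_iff_div_mem hb).2 (h w w.2 b hbW hw hb))
      exact ⟨c, Subtype.ext hc⟩
  · push Not at hW
    rw [(Submodule.eq_bot_iff W).2 hW]
    simp

theorem div_mem_of_finrank_le_one {W : Submodule F K} [Module.Finite F W]
    (h : Module.finrank F W ≤ 1) {a b : K} (ha : a ∈ W) (hb : b ∈ W) (hb0 : b ≠ 0) :
    a / b ∈ F := by
  obtain ⟨v, hv⟩ := finrank_le_one_iff.1 h
  obtain ⟨x, hx⟩ := hv ⟨a, ha⟩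
  obtain ⟨y, hy⟩ := hv ⟨b, hb⟩
  have hx' : (x : K) * v = a := congrArg Subtype.val hx
  have hy' : (y : K) * v = b := congrArg Subtype.val hy
  have hv0 : (v : K) ≠ 0 := by
    intro h0
    exact hb0 (by rw [← hy', h0, mul_zero])
  rw [← hx', ← hy', mul_div_mul_right _ _ hv0]
  exact F.div_mem x.2 y.2

theorem isSidonSpace_iff_finrank_inf_le_one {V : Submodule F K} [Module.Finite F V] :
    IsSidonSpace F V ↔ ∀ α : K, α ∉ F → Module.finrank F ↥(V ⊓ α • V) ≤ 1 := by
  constructor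
  · intro hS α hα
    have hα0 : α ≠ 0 := fun h => hα (h ▸ F.zero_mem)
    refine finrank_le_one_of_div_mem fun a ha d hd ha0 hd0 => ?_
    obtain ⟨haV, haα⟩ := Submodule.mem_inf.1 ha
    obtain ⟨hdV, hdα⟩ := Submodule.mem_inf.1 hd
    rw [mem_smul_submodule_iff hα0] at haα hdα
    have hc0 : α⁻¹ * a ≠ 0 := mul_ne_zero (inv_ne_zero hα0) ha0
    have hs := hS a haV (α⁻¹ * d) hdα (α⁻¹ * a) haα d hdV ha0
      (mul_ne_zero (inv_ne_zero hα0) hd0) hc0 hd0 (by ring)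
    have hmem : Submodule.span F {a} ∈
        ({Submodule.span F {α⁻¹ * a}, Submodule.span F {d}} : Set (Submodule F K)) := by
      rw [← hs]
      exact Set.mem_insert _ _
    rcases hmem with h | h
    · rw [span_singleton_eq_iff_div_mem ha0 hc0] at h
      refine absurd ?_ hα
      convert h using 1
      field_simp
    · exact (span_singleton_eq_iff_div_mem ha0 hd0).1 h
  · intro h a ha b hb c hc d hd ha0 hb0 hc0 hd0 habcd
    by_cases hα : a / c ∈ F
    · have hbd : b / d ∈ F := by
        convert F.inv_mem hα using 1
        field_simp
        linear_combination habcd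
      rw [(span_singleton_eq_iff_div_mem ha0 hc0).2 hα,
        (span_singleton_eq_iff_div_mem hb0 hd0).2 hbd]
    · have hα0 : a / c ≠ 0 := div_ne_zero ha0 hc0
      have haW : a ∈ V ⊓ (a / c) • V := by
        refine ⟨ha, (mem_smul_submodule_iff hα0).2 ?_⟩
        convert hc using 1
        field_simp
      have hdW : d ∈ V ⊓ (a / c) • V := by
        refine ⟨hd, (mem_smul_submodule_iff hα0).2 ?_⟩
        convert hb using 1
        field_simp
        linear_combination -habcd
      have : Module.Finite F ↥(V ⊓ (a / c) • V) :=
        Submodule.finiteDimensional_inf_left _ _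
      have had : a / d ∈ F := div_mem_of_finrank_le_one (h _ hα) haW hdW hd0
      have hbc : b / c ∈ F := by
        convert F.inv_mem had using 1
        field_simp
        linear_combination habcd
      rw [(span_singleton_eq_iff_div_mem ha0 hd0).2 had,
        (span_singleton_eq_iff_div_mem hb0 hc0).2 hbc, Set.pair_comm]

theorem mem_range_units_map_subtype_iff {u : Kˣ} :
    u ∈ (Units.map (F.subtype : F →* K)).range ↔ (u : K) ∈ F := by
  constructor
  · rintro ⟨x, rfl⟩
    exact (x : F).2
  · intro h
    exact ⟨Units.mk0 ⟨u, h⟩ fun h0 => u.ne_zero (congrArg Subtype.val h0), Units.ext rfl⟩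

/-- The orbit code of `V` has cardinality `(|K| - 1) / (|F| - 1)` exactly when
only the elements of `F` stabilize `V`. -/
theorem card_orbit_eq_iff [Finite K] (V : Submodule F K) :
    Nat.card {W : Submodule F K | ∃ α : K, α ≠ 0 ∧ W = α • V} =
        (Nat.card K - 1) / (Nat.card F - 1) ↔
      ∀ α : K, α ≠ 0 → α • V = V → α ∈ F := by
  have horb : {W : Submodule F K | ∃ α : K, α ≠ 0 ∧ W = α • V} = MulAction.orbit Kˣ V := by
    ext W
    constructor
    · rintro ⟨α, hα, rfl⟩
      exact ⟨Units.mk0 α hα, rfl⟩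
    · rintro ⟨u, rfl⟩
      exact ⟨u, u.ne_zero, rfl⟩
  set T : Subgroup Kˣ := (Units.map (F.subtype : F →* K)).range with hT
  set S := MulAction.stabilizer Kˣ V with hS
  have hTS : T ≤ S := fun u hu =>
    smul_submodule_eq_self u.ne_zero (mem_range_units_map_subtype_iff.1 hu) V
  have hTcard : Nat.card T = Nat.card F - 1 := by
    rw [← Nat.card_units]
    exact (Nat.card_congr (MonoidHom.ofInjective
      (Units.map_injective (f := (F.subtype : F →* K)) Subtype.val_injective)).toEquiv).symm
  have hST : (∀ α : K, α ≠ 0 → α • V = V → α ∈ F) ↔ S = T := by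
    constructor
    · intro h
      exact le_antisymm (fun (u : Kˣ) hu =>
        mem_range_units_map_subtype_iff.2 (h u u.ne_zero hu)) hTS
    · intro h α hα hαV
      have : Units.mk0 α hα ∈ T := h ▸ (show Units.mk0 α hα ∈ S from hαV)
      exact mem_range_units_map_subtype_iff.1 this
  have hmul : Nat.card (MulAction.orbit Kˣ V) * Nat.card S = Nat.card Kˣ := by
    rw [← Nat.card_prod]
    exact Nat.card_congr (MulAction.orbitProdStabilizerEquivGroup Kˣ V)
  have hdvd : Nat.card T ∣ Nat.card Kˣ := Subgroup.card_subgroup_dvd_card T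
  have hTpos : 0 < Nat.card T := Nat.card_pos
  have hKpos : 0 < Nat.card Kˣ := Nat.card_pos
  rw [horb, hST, ← hTcard, ← Nat.card_units]
  constructor
  · intro h
    refine (Subgroup.eq_of_le_of_card_ge hTS (le_of_eq ?_)).symm
    have h2 : Nat.card (MulAction.orbit Kˣ V) * Nat.card T = Nat.card Kˣ := by
      rw [h, Nat.div_mul_cancel hdvd]
    have h3 : 0 < Nat.card (MulAction.orbit Kˣ V) :=
      Nat.pos_of_mul_pos_right (hmul ▸ hKpos)
    exact Nat.eq_of_mul_eq_mul_left h3 (hmul.trans h2.symm)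
  · intro h
    rw [← hmul, h, Nat.mul_div_cancel _ hTpos]

end OrbitCode

/-- For a `k`-dimensional `F_q`-subspace `V` of `F_{q^n}` with `2 ≤ k ≤ n`,
the orbit code `orb(V) = {αV : α ≠ 0}` has cardinality `(qⁿ-1)/(q-1)` and minimum
subspace distance `2k - 2` if and only if `V` is a Sidon space. -/
theorem orbit_code_iff_sidonSpace {K : Type*} [Field K] (q n k : ℕ)
    (hq : IsPrimePow q) (hn : 0 < n) (hk : 2 ≤ k) (hkn : k ≤ n)
    (hK : Nat.card K = q ^ n)
    (F : Subfield K) (hF : Nat.card F = q)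
    (V : Submodule F K) (hV : Module.finrank F V = k) :
    (Nat.card {W : Submodule F K | ∃ α : K, α ≠ 0 ∧ W = α • V} = (q ^ n - 1) / (q - 1) ∧
        HasMinDist F {W : Submodule F K | ∃ α : K, α ≠ 0 ∧ W = α • V} (2 * k - 2)) ↔
      IsSidonSpace F V := by
  have hq1 : 1 < q := hq.one_lt
  have : Finite K := Nat.finite_of_card_ne_zero (by rw [hK]; positivity)
  rw [← hK, ← hF, card_orbit_eq_iff, isSidonSpace_iff_finrank_inf_le_one]
  constructor
  · rintro ⟨hstab, -, hlb⟩ α hα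
    have hα0 : α ≠ 0 := fun h => hα (h ▸ F.zero_mem)
    have hne : (1 : K) • V ≠ α • V := by
      rw [one_smul]
      exact fun h => hα (hstab α hα0 h.symm)
    have h := hlb ⟨_, ⟨1, one_ne_zero, rfl⟩, _, ⟨α, hα0, rfl⟩, hne, rfl⟩
    rw [subspaceDist_smul_smul one_ne_zero hα0, inv_one, one_mul, hV] at h
    omega
  · intro h
    have hstab : ∀ α : K, α ≠ 0 → α • V = V → α ∈ F := by
      intro α _ hαV
      by_contra hα
      have h1 := h α hα
      rw [hαV, inf_idem, hV] at h1
      omega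
    refine ⟨hstab, ?_, ?_⟩
    · have hquot : ∃ a ∈ V, ∃ b ∈ V, a ≠ 0 ∧ b ≠ 0 ∧ a / b ∉ F := by
        by_contra! hcon
        have := finrank_le_one_of_div_mem hcon
        omega
      obtain ⟨a, ha, b, hb, ha0, hb0, hab⟩ := hquot
      have hα0 : a / b ≠ 0 := div_ne_zero ha0 hb0
      refine ⟨_, ⟨1, one_ne_zero, rfl⟩, _, ⟨a / b, hα0, rfl⟩, ?_, ?_⟩
      · rw [one_smul]
        exact fun h' => hab (hstab _ hα0 h'.symm)
      · rw [subspaceDist_smul_smul one_ne_zero hα0, inv_one, one_mul, hV]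
        have haW : a ∈ V ⊓ (a / b) • V := by
          refine ⟨ha, (mem_smul_submodule_iff hα0).2 ?_⟩
          convert hb using 1
          field_simp
        have hpos : 0 < Module.finrank F ↥(V ⊓ (a / b) • V) :=
          Module.finrank_pos_iff_exists_ne_zero.2 ⟨⟨a, haW⟩, fun h0 => ha0 (congrArg Subtype.val h0)⟩
        have := h _ hab
        omega
    · rintro _ ⟨_, ⟨α, hα, rfl⟩, _, ⟨β, hβ, rfl⟩, hne, rfl⟩
      rw [subspaceDist_smul_smul hα hβ, hV]
      have hαβ : α⁻¹ * β ∉ F := by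
        intro hmem
        apply hne
        have h' := smul_submodule_eq_self (mul_ne_zero (inv_ne_zero hα) hβ) hmem V
        rw [← h', smul_smul, mul_inv_cancel_left₀ hα, h']
      have := h _ hαβ
      omega
end
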